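/- arXiv:2205.06717 — 6 statements merged into one kernel-verified Lean document; each statement's English description precedes it below -/
import Mathlib

section
/- Let G be a finite simple graph containing a Hamiltonian path, and let g and f be integer-valued functions on V(G) with 2 ≤ g(v) ≤ f(v) for every vertex v. If G contains a spanning subgraph F such that g(v) ≤ deg_F(v) ≤ f(v) for every vertex v, then G contains a connected spanning subgraph H such that g(v) ≤ deg_H(v) ≤ f(v) + 1 for every vertex v. -/
open scoped Classical

/-- A Hamiltonian path of `G` is a path in `G` visiting every vertex exactly once. -/
def SimpleGraph.HasHamiltonianPath {V : Type*} (G : SimpleGraph V) : Prop :=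
  ∃ (u w : V) (p : G.Walk u w), p.IsPath ∧ p.IsHamiltonian

namespace SimpleGraph

variable {V : Type*}

/-- In a finite graph of minimum degree at least two, every component has an edge that is not a
bridge. -/
lemma exists_reachable_adj_not_isBridge [Fintype V] (F : SimpleGraph V)
    (hF : ∀ v, 2 ≤ F.degree v) (u : V) :
    ∃ a b, F.Adj a b ∧ F.Reachable u a ∧ ¬ F.IsBridge s(a, b) := by
  by_contra! hcon
  let C := F.connectedComponentMk u
  have hac : C.toSimpleGraph.IsAcyclic := by
    rw [isAcyclic_iff_forall_adj_isBridge]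
    rintro ⟨a, ha⟩ ⟨b, hb⟩ hab
    have hab' : F.Adj a b := hab
    have hbr := hcon a b hab'
      (ConnectedComponent.exact (show F.connectedComponentMk a = C from ha)).symm
    rw [isBridge_iff] at hbr ⊢
    refine fun h => hbr ?_
    let φ : (C.toSimpleGraph.deleteEdges {s(⟨a, ha⟩, ⟨b, hb⟩)}) →g F.deleteEdges {s(a, b)} :=
      { toFun := Subtype.val
        map_rel' := by
          rintro ⟨x, hx⟩ ⟨y, hy⟩ hxy
          rw [deleteEdges_adj] at hxy ⊢
          refine ⟨hxy.1, ?_⟩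
          simpa [Sym2.eq_iff] using hxy.2 }
    exact h.map φ
  have htree : C.toSimpleGraph.IsTree := ⟨C.connected_toSimpleGraph, hac⟩
  have hdeg : ∀ x : C, C.toSimpleGraph.degree x = F.degree x := by
    intro x
    have hx : F.neighborSet x ⊆ C.supp := fun y hy => C.mem_supp_of_adj_mem_supp x.2 hy
    rw [← degree_induce_of_neighborSet_subset hx]
    rfl
  have huC : u ∈ C.supp := rfl
  obtain ⟨w, hw⟩ : ∃ w, F.Adj u w := by
    have := hF u
    rw [← F.degree_pos_iff_exists_adj]; omega
  have : Nontrivial C :=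
    ⟨⟨u, huC⟩, ⟨w, C.mem_supp_of_adj_mem_supp huC hw⟩, fun h => hw.ne (congrArg Subtype.val h)⟩
  obtain ⟨x, hx⟩ := htree.exists_vert_degree_one_of_nontrivial
  have h1 := hdeg x
  have h2 := hF x
  have h3 : C.toSimpleGraph.degree x = 1 := by convert hx
  omega

/-- The graph whose edges are the `v i — v (i + 1)` with `i + 1 ∈ T`. -/
def sequenceGraph (v : ℕ → V) (T : Set ℕ) : SimpleGraph V :=
  fromRel fun a b => ∃ i, i + 1 ∈ T ∧ a = v i ∧ b = v (i + 1)

lemma sequenceGraph_mono (v : ℕ → V) {S T : Set ℕ} (h : S ⊆ T) :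
    sequenceGraph v S ≤ sequenceGraph v T := by
  intro a b hab
  simp only [sequenceGraph, fromRel_adj] at hab ⊢
  refine ⟨hab.1, hab.2.imp ?_ ?_⟩ <;> rintro ⟨i, hi, h'⟩ <;> exact ⟨i, h hi, h'⟩

lemma sequenceGraph_reachable {v : ℕ → V} {T : Set ℕ} {i : ℕ} (hi : i + 1 ∈ T) :
    (sequenceGraph v T).Reachable (v i) (v (i + 1)) := by
  by_cases h : v i = v (i + 1)
  · rw [← h]
  · refine Adj.reachable ?_
    rw [sequenceGraph, fromRel_adj]
    exact ⟨h, Or.inl ⟨i, hi, rfl, rfl⟩⟩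

/-- Selection of the edges of the sequence `v 0, …, v N` by which the components of `F` are joined:
consecutive edges are selected only at indices satisfying `good`, and exactly one of the two edges
at an index satisfying `Y` is selected. -/
lemma exists_sequenceGraph_selection (F : SimpleGraph V) (v : ℕ → V) (N : ℕ) (good Y : ℕ → Prop)
    (hgood : ∀ u, ∃ j ≤ N, good j ∧ F.Reachable u (v j))
    (hY : ∀ i, Y i → ¬ F.Adj (v i) (v (i + 1)) ∧
      ∃ j > i, j ≤ N ∧ good j ∧ F.Reachable (v i) (v j)) (b : ℕ) (hb : b ≤ N) :
    ∃ T : Set ℕ, 0 ∉ T ∧ (∀ i ∈ T, i ≤ b) ∧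
      (∀ i, i + 1 ∈ T → ¬ F.Adj (v i) (v (i + 1))) ∧
      (∀ i, i ∈ T → i + 1 ∈ T → good i) ∧
      (∀ i < b, Y i → (i + 1 ∈ T ↔ i ∉ T)) ∧
      (∀ u, (F ⊔ sequenceGraph v T).Reachable u (v b) ∨
        ∃ j > b, j ≤ N ∧ good j ∧ (F ⊔ sequenceGraph v T).Reachable u (v j)) ∧
      (b ∈ T → good b ∨
        ∃ j > b, j ≤ N ∧ good j ∧ (F ⊔ sequenceGraph v T).Reachable (v b) (v j)) := by
  induction b with
  | zero =>
    refine ⟨∅, by simp, by simp, by simp, by simp, by simp, fun u => ?_, by simp⟩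
    obtain ⟨j, hj, hg, hr⟩ := hgood u
    have hr' := hr.mono (le_sup_left : F ≤ F ⊔ sequenceGraph v ∅)
    rcases Nat.eq_zero_or_pos j with rfl | h
    · exact Or.inl hr'
    · exact Or.inr ⟨j, h, hj, hg, hr'⟩
  | succ b ih =>
    obtain ⟨T, h0, hT, hadj, hcons, hYT, hreach, hend⟩ := ih (by omega)
    have hb1 : b + 1 ∉ T := fun h => by have := hT _ h; omega
    set J := F ⊔ sequenceGraph v T with hJ
    have hFJ : F ≤ J := le_sup_left
    have hskip : ((∃ j > b, j ≤ N ∧ good j ∧ J.Reachable (v b) (v j)) ∨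
        J.Reachable (v b) (v (b + 1))) → ∀ u, J.Reachable u (v (b + 1)) ∨
        ∃ j > b + 1, j ≤ N ∧ good j ∧ J.Reachable u (v j) := by
      intro hor u
      have key : ∀ w, (∃ j > b, j ≤ N ∧ good j ∧ J.Reachable w (v j)) →
          J.Reachable w (v (b + 1)) ∨ ∃ j > b + 1, j ≤ N ∧ good j ∧ J.Reachable w (v j) := by
        rintro w ⟨j, hj, hjN, hg, hr⟩
        rcases (Nat.succ_le_of_lt hj).eq_or_lt with rfl | h
        · exact Or.inl hr
        · exact Or.inr ⟨j, h, hjN, hg, hr⟩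
      rcases hreach u with h | h
      · rcases hor with ⟨j, hj, hjN, hg, hr⟩ | h'
        · exact key u ⟨j, hj, hjN, hg, h.trans hr⟩
        · exact Or.inl (h.trans h')
      · exact key u h
    by_cases hkeep : (Y b ∧ b ∉ T) ∨ (¬ Y b ∧
        ¬ (∃ j > b, j ≤ N ∧ good j ∧ J.Reachable (v b) (v j)) ∧ ¬ J.Reachable (v b) (v (b + 1)))
    · set J' := F ⊔ sequenceGraph v (insert (b + 1) T) with hJ'
      have hJJ' : J ≤ J' := sup_le_sup_left (sequenceGraph_mono v (Set.subset_insert _ _)) _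
      have hnew : J'.Reachable (v b) (v (b + 1)) :=
        (sequenceGraph_reachable (Set.mem_insert _ _)).mono le_sup_right
      have halive : good (b + 1) ∨
          ∃ j > b + 1, j ≤ N ∧ good j ∧ J'.Reachable (v (b + 1)) (v j) := by
        have key : ∀ w, J'.Reachable (v (b + 1)) w →
            (∃ j > b, j ≤ N ∧ good j ∧ J'.Reachable w (v j)) → good (b + 1) ∨
            ∃ j > b + 1, j ≤ N ∧ good j ∧ J'.Reachable (v (b + 1)) (v j) := by
          rintro w hw ⟨j, hj, hjN, hg, hr⟩
          rcases (Nat.succ_le_of_lt hj).eq_or_lt with rfl | h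
          · exact Or.inl hg
          · exact Or.inr ⟨j, h, hjN, hg, hw.trans hr⟩
        rcases hkeep with ⟨hy, -⟩ | ⟨-, -, hn⟩
        · obtain ⟨-, j, hj, hjN, hg, hr⟩ := hY b hy
          exact key (v b) hnew.symm ⟨j, hj, hjN, hg, hr.mono (hFJ.trans hJJ')⟩
        · rcases hreach (v (b + 1)) with h | ⟨j, hj, hjN, hg, hr⟩
          · exact absurd h.symm hn
          · exact key _ (Reachable.refl _) ⟨j, hj, hjN, hg, hr.mono hJJ'⟩
      refine ⟨insert (b + 1) T, by simp [h0], ?_, ?_, ?_, ?_, ?_, fun _ => halive⟩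
      · rintro i (rfl | hi)
        · exact le_rfl
        · have := hT i hi; omega
      · rintro i (hi | hi)
        · obtain rfl : i = b := by omega
          rcases hkeep with ⟨hy, -⟩ | ⟨-, -, hn⟩
          · exact (hY i hy).1
          · exact fun h => hn (h.reachable.mono hFJ)
        · exact hadj i hi
      · rintro i (hi | hi) (hi' | hi')
        · omega
        · have := hT _ hi'; omega
        · obtain rfl : i = b := by omega
          rcases hkeep with ⟨-, hn⟩ | ⟨-, hn, -⟩
          · exact absurd hi hn
          · exact (hend hi).resolve_right hn
        · exact hcons i hi hi'
      · intro i hi hy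
        rcases (Nat.lt_succ_iff.mp hi).eq_or_lt with rfl | h
        · have : i ∉ T := by
            rcases hkeep with h | h
            · exact h.2
            · exact absurd hy h.1
          simp [this]
        · have h1 : i ≠ b := by omega
          have h2 : i ≠ b + 1 := by omega
          simpa [h1, h2] using hYT i h hy
      · intro u
        rcases hreach u with h | ⟨j, hj, hjN, hg, hr⟩
        · exact Or.inl ((h.mono hJJ').trans hnew)
        · rcases (Nat.succ_le_of_lt hj).eq_or_lt with rfl | h
          · exact Or.inl (hr.mono hJJ')
          · exact Or.inr ⟨j, h, hjN, hg, hr.mono hJJ'⟩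
    · have hor : (∃ j > b, j ≤ N ∧ good j ∧ J.Reachable (v b) (v j)) ∨
          J.Reachable (v b) (v (b + 1)) := by
        by_cases hy : Y b
        · obtain ⟨-, j, hj, hjN, hg, hr⟩ := hY b hy
          exact Or.inl ⟨j, hj, hjN, hg, hr.mono hFJ⟩
        · by_contra hn
          rw [not_or] at hn
          exact hkeep (Or.inr ⟨hy, hn⟩)
      refine ⟨T, h0, fun i hi => (hT i hi).trans (Nat.le_succ b), hadj, hcons, ?_,
        hskip hor, fun h => absurd h hb1⟩
      intro i hi hy
      rcases (Nat.lt_succ_iff.mp hi).eq_or_lt with rfl | h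
      · have : i ∈ T := by_contra fun hi' => hkeep (Or.inl ⟨hy, hi'⟩)
        simp [this, hb1]
      · exact hYT i h hy

/-- A choice of one non-bridge edge in each component of `F` containing no edge of the sequence
`v 0, …, v N`. -/
lemma exists_nonbridge_selection [Fintype V] (F : SimpleGraph V) (hF : ∀ v, 2 ≤ F.degree v)
    (v : ℕ → V) (N : ℕ) (hv : ∀ u, ∃ i ≤ N, v i = u) :
    ∃ M : ℕ → ℕ → Prop,
      (∀ i j, M i j → i < j ∧ j ≤ N ∧ F.Adj (v i) (v j) ∧ ¬ F.IsBridge s(v i, v j) ∧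
        ∀ k < N, F.Adj (v k) (v (k + 1)) → ¬ F.Reachable (v i) (v k)) ∧
      (∀ i j i' j', M i j → M i' j' → F.Reachable (v i) (v i') → i = i' ∧ j = j') ∧
      ∀ u, (∃ k < N, F.Adj (v k) (v (k + 1)) ∧ F.Reachable u (v k)) ∨
        ∃ i j, M i j ∧ F.Reachable u (v i) := by
  have h : ∀ C : F.ConnectedComponent, ∃ i j, i < j ∧ j ≤ N ∧ F.Adj (v i) (v j) ∧
      ¬ F.IsBridge s(v i, v j) ∧ F.connectedComponentMk (v i) = C := by
    intro C
    induction C using ConnectedComponent.ind with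
    | h u =>
      obtain ⟨a, b, hab, hua, hbr⟩ := exists_reachable_adj_not_isBridge F hF u
      obtain ⟨i, hi, rfl⟩ := hv a
      obtain ⟨j, hj, rfl⟩ := hv b
      rcases lt_trichotomy i j with hij | rfl | hij
      · exact ⟨i, j, hij, hj, hab, hbr, ConnectedComponent.sound hua.symm⟩
      · exact absurd hab (F.irrefl)
      · exact ⟨j, i, hij, hi, hab.symm, by rwa [Sym2.eq_swap],
          ConnectedComponent.sound (hua.trans hab.reachable).symm⟩
  choose y z hyz hz hadj hbr hC using h
  refine ⟨fun i j => ∃ C : F.ConnectedComponent, (∀ k < N, F.Adj (v k) (v (k + 1)) →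
    F.connectedComponentMk (v k) ≠ C) ∧ i = y C ∧ j = z C, ?_, ?_, ?_⟩
  · rintro _ _ ⟨C, hp, rfl, rfl⟩
    refine ⟨hyz C, hz C, hadj C, hbr C, fun k hk hka hr => hp k hk hka ?_⟩
    rw [← ConnectedComponent.sound hr, hC]
  · rintro _ _ _ _ ⟨C, -, rfl, rfl⟩ ⟨C', -, rfl, rfl⟩ hr
    have : C = C' := by rw [← hC C, ConnectedComponent.sound hr, hC]
    subst this
    exact ⟨rfl, rfl⟩
  · intro u
    by_cases hp : ∀ k < N, F.Adj (v k) (v (k + 1)) →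
        F.connectedComponentMk (v k) ≠ F.connectedComponentMk u
    · exact Or.inr ⟨_, _, ⟨_, hp, rfl, rfl⟩, ConnectedComponent.exact (hC _).symm⟩
    · push Not at hp
      obtain ⟨k, hk, hka, hkC⟩ := hp
      exact Or.inl ⟨k, hk, hka, ConnectedComponent.exact hkC.symm⟩

/-- A graph of minimum degree at least two extends, up to deleting edges, along a spanning sequence
of distinct vertices to a connected graph without lowering any degree or raising it by more than
one. -/
lemma exists_connected_degree_le_succ [Fintype V] (F : SimpleGraph V) (hF : ∀ v, 2 ≤ F.degree v)
    (v : ℕ → V) (N : ℕ) (hv : ∀ u, ∃ i ≤ N, v i = u)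
    (hinj : ∀ i ≤ N, ∀ j ≤ N, v i = v j → i = j) :
    ∃ H : SimpleGraph V, H.Connected ∧
      (∀ a b, H.Adj a b → F.Adj a b ∨ ∃ i < N, s(a, b) = s(v i, v (i + 1))) ∧
      ∀ u, F.degree u ≤ H.degree u ∧ H.degree u ≤ F.degree u + 1 := by
  obtain ⟨M, hM, hMuniq, hMcov⟩ := exists_nonbridge_selection F hF v N hv
  let good : ℕ → Prop := fun k =>
    (k < N ∧ F.Adj (v k) (v (k + 1))) ∨ (∃ i, i + 1 = k ∧ F.Adj (v i) (v k)) ∨ ∃ i, M i k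
  obtain ⟨T, h0, hT, hTadj, hcons, hYT, hreach, -⟩ :=
    exists_sequenceGraph_selection F v N good (fun i => ∃ j, M i j) (by
      intro u
      rcases hMcov u with ⟨k, hk, hka, hr⟩ | ⟨i, j, hij, hr⟩
      · exact ⟨k, hk.le, Or.inl ⟨hk, hka⟩, hr⟩
      · obtain ⟨-, hj, ha, -⟩ := hM i j hij
        exact ⟨j, hj, Or.inr (Or.inr ⟨i, hij⟩), hr.trans ha.reachable⟩) (by
      rintro i ⟨j, hij⟩
      obtain ⟨hlt, hj, ha, -, hp⟩ := hM i j hij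
      exact ⟨fun h => hp i (by omega) h (Reachable.refl _),
        j, hlt, hj, Or.inr (Or.inr ⟨i, hij⟩), ha.reachable⟩) N le_rfl
  let Del : V → V → Prop := fun a b => ∃ i j, M i j ∧ j ∈ T ∧ j + 1 ∈ T ∧ s(a, b) = s(v i, v j)
  let S := sequenceGraph v T
  have hDel_symm : ∀ a b, Del a b → Del b a := by
    rintro a b ⟨i, j, h1, h2, h3, h4⟩
    exact ⟨i, j, h1, h2, h3, by rw [Sym2.eq_swap, h4]⟩
  obtain ⟨H, hH⟩ : ∃ H : SimpleGraph V, ∀ a b, H.Adj a b ↔ (F.Adj a b ∧ ¬ Del a b) ∨ S.Adj a b :=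
    ⟨{ Adj := fun a b => (F.Adj a b ∧ ¬ Del a b) ∨ S.Adj a b
       symm := ⟨fun a b h => h.imp (fun h => ⟨h.1.symm, fun h' => h.2 (hDel_symm _ _ h')⟩)
         fun h => h.symm⟩
       loopless := ⟨fun a h => h.elim (fun h => F.irrefl h.1) fun h => S.irrefl h⟩ },
      fun _ _ => Iff.rfl⟩
  have hSadj : ∀ k ≤ N, ∀ w, S.Adj (v k) w ↔
      (k ∈ T ∧ w = v (k - 1)) ∨ (k + 1 ∈ T ∧ w = v (k + 1)) := by
    intro k hk w
    simp only [S, sequenceGraph, fromRel_adj]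
    constructor
    · rintro ⟨-, ⟨i, hi, h1, rfl⟩ | ⟨i, hi, rfl, h1⟩⟩
      · have := hT _ hi
        obtain rfl := hinj k hk i (by omega) h1
        exact Or.inr ⟨hi, rfl⟩
      · have := hT _ hi
        obtain rfl := hinj k hk (i + 1) this h1
        exact Or.inl ⟨hi, rfl⟩
    · rintro (⟨hi, rfl⟩ | ⟨hi, rfl⟩)
      · obtain ⟨i, rfl⟩ : ∃ i, k = i + 1 := Nat.exists_eq_succ_of_ne_zero fun h => h0 (h ▸ hi)
        refine ⟨fun h => ?_, Or.inr ⟨i, hi, rfl, rfl⟩⟩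
        have := hinj _ hk i (by omega) h
        omega
      · have h2 := hT _ hi
        refine ⟨fun h => ?_, Or.inl ⟨k, hi, rfl, rfl⟩⟩
        have := hinj _ hk _ h2 h
        omega
  have hSF : ∀ a b, S.Adj a b → ¬ F.Adj a b := by
    intro a b hab
    simp only [S, sequenceGraph, fromRel_adj] at hab
    rcases hab with ⟨-, ⟨i, hi, rfl, rfl⟩ | ⟨i, hi, rfl, rfl⟩⟩
    · exact hTadj i hi
    · exact fun h => hTadj i hi h.symm
  refine ⟨H, ?_, ?_, ?_⟩
  · have hFH : ∀ a b, F.Adj a b → H.Reachable a b := by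
      intro a b hab
      by_cases hd : Del a b
      · obtain ⟨i, j, hij, -, -, he⟩ := hd
        obtain ⟨-, -, ha, hbr, -⟩ := hM i j hij
        have hfrom : ∀ w, (F.deleteEdges {s(v i, v j)}).Reachable (v i) w →
            H.Reachable (v i) w ∧ F.Reachable (v i) w := by
          intro w hw
          rw [reachable_iff_reflTransGen] at hw
          induction hw with
          | refl => exact ⟨Reachable.refl _, Reachable.refl _⟩
          | @tail c d _ hcd ih =>
            rw [deleteEdges_adj] at hcd
            refine ⟨ih.1.trans (Adj.reachable ((hH _ _).mpr (Or.inl ⟨hcd.1, ?_⟩))),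
              ih.2.trans hcd.1.reachable⟩
            rintro ⟨i', j', hij', -, -, he'⟩
            have hr : F.Reachable (v i) (v i') := by
              rcases Sym2.eq_iff.mp he' with ⟨rfl, -⟩ | ⟨-, rfl⟩
              · exact ih.2
              · exact ih.2.trans hcd.1.reachable
            obtain ⟨rfl, rfl⟩ := hMuniq _ _ _ _ hij hij' hr
            exact hcd.2 he'
        have hij' : H.Reachable (v i) (v j) := by
          rw [isBridge_iff, not_not] at hbr
          exact (hfrom _ hbr).1
        rcases Sym2.eq_iff.mp he with ⟨rfl, rfl⟩ | ⟨rfl, rfl⟩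
        · exact hij'
        · exact hij'.symm
      · exact Adj.reachable ((hH _ _).mpr (Or.inl ⟨hab, hd⟩))
    have hJH : ∀ a b, (F ⊔ S).Reachable a b → H.Reachable a b := by
      intro a b hab
      rw [reachable_iff_reflTransGen] at hab
      induction hab with
      | refl => exact Reachable.refl _
      | tail _ hcd ih =>
        rcases hcd with h | h
        · exact ih.trans (hFH _ _ h)
        · exact ih.trans (Adj.reachable ((hH _ _).mpr (Or.inr h)))
    have hN : ∀ u, H.Reachable u (v N) := by
      intro u
      rcases hreach u with h | ⟨j, hj, hjN, -⟩
      · exact hJH _ _ h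
      · omega
    exact { preconnected := fun a b => (hN a).trans (hN b).symm, nonempty := ⟨v 0⟩ }
  · intro a b hab
    rcases (hH a b).mp hab with ⟨h, -⟩ | h
    · exact Or.inl h
    · simp only [S, sequenceGraph, fromRel_adj] at h
      rcases h with ⟨-, ⟨i, hi, rfl, rfl⟩ | ⟨i, hi, rfl, rfl⟩⟩
      · exact Or.inr ⟨i, hT _ hi, rfl⟩
      · exact Or.inr ⟨i, hT _ hi, Sym2.eq_swap⟩
  · intro u
    obtain ⟨k, hk, rfl⟩ := hv u
    let D : Finset V := Finset.univ.filter (Del (v k))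
    have hHn : H.degree (v k) = (F.neighborFinset (v k) \ D).card + S.degree (v k) := by
      rw [← card_neighborFinset_eq_degree, ← card_neighborFinset_eq_degree,
        ← Finset.card_union_of_disjoint]
      · congr 1
        ext w
        simp [hH, D]
      · rw [Finset.disjoint_left]
        intro w hw hw'
        simp only [Finset.mem_sdiff, mem_neighborFinset] at hw hw'
        exact hSF _ _ hw' hw.1
    have hDF : D ⊆ F.neighborFinset (v k) := by
      intro w hw
      obtain ⟨i, j, hij, -, -, he⟩ := (Finset.mem_filter.mp hw).2
      have ha := (hM i j hij).2.2.1
      rw [mem_neighborFinset]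
      rcases Sym2.eq_iff.mp he with ⟨h1, rfl⟩ | ⟨h1, rfl⟩
      · rwa [h1]
      · rw [h1]; exact ha.symm
    have hdeg : H.degree (v k) + D.card = F.degree (v k) + S.degree (v k) := by
      have h1 := Finset.card_sdiff_add_card_eq_card hDF
      rw [card_neighborFinset_eq_degree] at h1
      omega
    have hDuniq : D.card ≤ 1 := by
      rw [Finset.card_le_one]
      intro a ha b hb
      obtain ⟨i, j, hij, -, -, he⟩ := (Finset.mem_filter.mp ha).2
      obtain ⟨i', j', hij', -, -, he'⟩ := (Finset.mem_filter.mp hb).2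
      have key : ∀ w i j, M i j → s(v k, w) = s(v i, v j) → F.Reachable (v k) (v i) := by
        intro w i j hij he
        rcases Sym2.eq_iff.mp he with ⟨h, -⟩ | ⟨h, -⟩
        · rw [h]
        · rw [h]; exact (hM i j hij).2.2.1.symm.reachable
      obtain ⟨rfl, rfl⟩ :=
        hMuniq _ _ _ _ hij hij' ((key _ _ _ hij he).symm.trans (key _ _ _ hij' he'))
      exact Sym2.congr_right.mp (he.trans he'.symm)
    have hSdeg : S.degree (v k) = (if k ∈ T then 1 else 0) + (if k + 1 ∈ T then 1 else 0) := by
      have hset : S.neighborFinset (v k) =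
          (if k ∈ T then {v (k - 1)} else ∅) ∪ (if k + 1 ∈ T then {v (k + 1)} else ∅) := by
        ext w
        rw [mem_neighborFinset, hSadj k hk]
        split_ifs <;> simp [*]
      rw [← card_neighborFinset_eq_degree, hset, Finset.card_union_of_disjoint]
      · split_ifs <;> simp
      · split_ifs with h1 h2
        · rw [Finset.disjoint_singleton]
          intro h
          have := hT _ h2
          have := hinj _ (by omega) _ (by omega) h
          omega
        all_goals simp
    have hDcase : D.Nonempty → (k ∈ T ∧ k + 1 ∈ T) ∨ (k ∈ T ↔ k + 1 ∉ T) := by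
      rintro ⟨w, hw⟩
      obtain ⟨i, j, hij, hj, hj', he⟩ := (Finset.mem_filter.mp hw).2
      obtain ⟨hlt, hjN, -⟩ := hM i j hij
      rcases Sym2.eq_iff.mp he with ⟨h, -⟩ | ⟨h, -⟩
      · obtain rfl := hinj k hk i (by omega) h
        have := hYT k (by omega) ⟨j, hij⟩
        tauto
      · obtain rfl := hinj k hk j hjN h
        exact Or.inl ⟨hj, hj'⟩
    have hboth : k ∈ T → k + 1 ∈ T → D.Nonempty := by
      intro h1 h2
      rcases hcons k h1 h2 with ⟨-, h⟩ | ⟨i, rfl, h⟩ | ⟨i, hik⟩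
      · exact absurd h (hTadj k h2)
      · exact absurd h (hTadj i h1)
      · exact ⟨v i, Finset.mem_filter.mpr
          ⟨Finset.mem_univ _, i, k, hik, h1, h2, Sym2.eq_swap⟩⟩
    rw [← Finset.card_pos] at hDcase hboth
    by_cases h1 : k ∈ T <;> by_cases h2 : k + 1 ∈ T <;>
      simp only [h1, h2, if_true, if_false] at hSdeg
    · have := hboth h1 h2
      omega
    · omega
    · omega
    · have : ¬ 0 < D.card := fun h => by have := hDcase h; tauto
      omega

end SimpleGraph

/-- Tokuda–Xu–Wang / Li–Xu–Chen–Liu: if `G` has a Hamiltonian path and a `(g,f)`-factor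
(with `2 ≤ g ≤ f`), then `G` has a connected `(g, f+1)`-factor. -/
theorem connected_factor_of_hamiltonianPath {V : Type*} [Fintype V]
    (G : SimpleGraph V) (g f : V → ℤ)
    (hg2 : ∀ v, 2 ≤ g v) (hgf : ∀ v, g v ≤ f v)
    (hham : G.HasHamiltonianPath)
    (F : SimpleGraph V) (hFG : F ≤ G)
    (hFdeg : ∀ v, g v ≤ (F.degree v : ℤ) ∧ (F.degree v : ℤ) ≤ f v) :
    ∃ H : SimpleGraph V, H ≤ G ∧ H.Connected ∧
      ∀ v, g v ≤ (H.degree v : ℤ) ∧ (H.degree v : ℤ) ≤ f v + 1 := by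
  obtain ⟨u, w, p, hp, hham⟩ := hham
  obtain ⟨H, hconn, hadj, hdeg⟩ := F.exists_connected_degree_le_succ
    (fun v => by have := hg2 v; have := (hFdeg v).1; omega) p.getVert p.length
    (fun x => by
      obtain ⟨i, hi, hle⟩ := SimpleGraph.Walk.mem_support_iff_exists_getVert.mp (hham.mem_support x)
      exact ⟨i, hle, hi⟩)
    (fun i hi j hj h => hp.getVert_injOn hi hj h)
  refine ⟨H, fun a b hab => ?_, hconn, fun v => ?_⟩
  · rcases hadj a b hab with h | ⟨i, hi, he⟩
    · exact hFG h
    · rw [← SimpleGraph.mem_edgeSet, he]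
      exact p.adj_getVert_succ hi
  · have h1 := hdeg v
    have h2 := hFdeg v
    omega
end

section
/- Let G be a finite simple graph and let g, f, f' be integer-valued functions on V(G) with 1 ≤ g(v) ≤ f(v) and 1 ≤ f'(v) for every vertex v. If G contains a spanning subgraph F with g(v) ≤ deg_F(v) ≤ f(v) for every vertex v, and G contains a spanning tree T with deg_T(v) ≤ f'(v) for every vertex v, then G contains a connected spanning subgraph H such that g(v) ≤ deg_H(v) ≤ f(v) + f'(v) − 1 for every vertex v. -/
open scoped Classical

namespace SimpleGraph

variable {V : Type*}

lemma degree_eq_of_eq_sup_edge [Fintype V] {H K : SimpleGraph V} {a b : V} (hab : a ≠ b)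
    (h : ¬ H.Adj a b) (hK : K = H ⊔ edge a b) (v : V) :
    K.degree v = H.degree v + if v = a ∨ v = b then 1 else 0 := by
  have hadj : ∀ c d, K.Adj c d ↔ H.Adj c d ∨ c = a ∧ d = b ∨ c = b ∧ d = a := by
    intro c d
    rw [hK, sup_adj, edge_adj]
    grind
  have hsymm : ¬ H.Adj b a := fun h' => h h'.symm
  have key : ∀ c d : V, ¬ H.Adj c d → (∀ w, K.Adj c w ↔ w = d ∨ H.Adj c w) →
      K.degree c = H.degree c + 1 := by
    intro c d hn hc
    rw [← card_neighborFinset_eq_degree, ← card_neighborFinset_eq_degree,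
      ← Finset.card_insert_of_notMem (a := d) (s := H.neighborFinset c) (by simpa using hn)]
    congr 1
    ext w
    simp [hc]
  by_cases hva : v = a
  · subst hva
    simpa using key v b h (by grind)
  by_cases hvb : v = b
  · subst hvb
    simpa using key v a hsymm (by grind)
  · simp only [hva, hvb, or_self, if_false, add_zero]
    rw [← card_neighborFinset_eq_degree, ← card_neighborFinset_eq_degree]
    congr 1
    ext w
    simp [hadj, hva, hvb]

lemma eq_deleteEdges_sup_edge_of_adj {K : SimpleGraph V} {a b : V} (h : K.Adj a b) :
    K = K.deleteEdges {s(a, b)} ⊔ edge a b := by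
  ext c d
  simp only [sup_adj, deleteEdges_adj, edge_adj, Set.mem_singleton_iff, Sym2.eq_iff]
  have := h.symm
  have := h.ne
  grind

lemma degree_eq_of_eq_deleteEdges [Fintype V] {J K : SimpleGraph V} {a b : V}
    (h : K.Adj a b) (hJ : J = K.deleteEdges {s(a, b)}) (v : V) :
    K.degree v = J.degree v + if v = a ∨ v = b then 1 else 0 :=
  degree_eq_of_eq_sup_edge h.ne (by simp [hJ]) (hJ ▸ eq_deleteEdges_sup_edge_of_adj h) v

lemma not_adj_and_adj_of_degree_add_le [Fintype V] {F T K : SimpleGraph V} (hK : K ≤ F ⊔ T)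
    {u : V} (hd : F.degree u + T.degree u ≤ K.degree u) (w : V) :
    ¬ (F.Adj u w ∧ T.Adj u w) := by
  intro hw
  have hsub : K.neighborFinset u ⊆ F.neighborFinset u ∪ T.neighborFinset u := by
    intro z hz
    simpa using hK (by simpa using hz : K.Adj u z)
  have h1 := Finset.card_le_card hsub
  have h2 := Finset.card_union_add_card_inter (F.neighborFinset u) (T.neighborFinset u)
  have h3 : 0 < (F.neighborFinset u ∩ T.neighborFinset u).card :=
    Finset.card_pos.mpr ⟨w, by simpa using hw⟩
  simp only [card_neighborFinset_eq_degree] at h1 h2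
  omega

/-- Adding an edge `xu` to a connected graph closes a cycle, so some other edge at `u`
can be removed without disconnecting the graph. -/
lemma Connected.exists_connected_deleteEdges_sup_edge {H : SimpleGraph V} (hH : H.Connected)
    {x u : V} (hxu : x ≠ u) (h : ¬ H.Adj x u) :
    ∃ y, y ≠ x ∧ H.Adj u y ∧ ((H ⊔ edge x u).deleteEdges {s(u, y)}).Connected := by
  obtain ⟨p, hp⟩ := hH.exists_isPath u x
  cases p with
  | nil => exact absurd rfl hxu
  | @cons _ y _ huy q =>
    have hyx : y ≠ x := by rintro rfl; exact h huy.symm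
    refine ⟨y, hyx, huy, ?_⟩
    apply (hH.mono le_sup_left).connected_delete_edge_of_not_isBridge
    rw [isBridge_iff, not_not]
    have hadj : ((H ⊔ edge x u).deleteEdges {s(u, y)}).Adj u x := by
      simp only [deleteEdges_adj, sup_adj, edge_adj, Set.mem_singleton_iff, Sym2.eq_iff]
      grind
    have hu : s(u, y) ∉ q.edges := fun hmem =>
      ((Walk.cons_isPath_iff _ _).mp hp).2 (q.fst_mem_support_of_mem_edges hmem)
    have hq : (H.deleteEdges {s(u, y)}).Reachable y x := (q.toDeleteEdge _ hu).reachable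
    exact hadj.reachable.trans
      (hq.mono (deleteEdges_mono le_sup_left)).symm

/-- If every edge of `F` outside `T` has an end of `F`-degree one, then a connected subgraph of
`F ⊔ T` that satisfies the upper degree bounds and has as much of `F` as possible also satisfies
the lower bounds. -/
lemma Connected.exists_connected_degree_bounds_of_pendant [Fintype V] [Nontrivial V]
    {F T : SimpleGraph V} (hT : T.Connected) (hF : ∀ v, 1 ≤ F.degree v)
    (hpend : ∀ x u, F.Adj x u → ¬ T.Adj x u → 2 ≤ F.degree x → F.degree u ≤ 1) :
    ∃ H ≤ F ⊔ T, H.Connected ∧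
      ∀ v, F.degree v ≤ H.degree v ∧ H.degree v + 1 ≤ F.degree v + T.degree v := by
  have hTpos : ∀ v, 0 < T.degree v :=
    fun v => hT.preconnected.degree_pos_of_nontrivial v
  let S : Set (SimpleGraph V) := {H | H ≤ F ⊔ T ∧ H.Connected ∧
    ∀ v, H.degree v + 1 ≤ F.degree v + T.degree v}
  have hTS : T ∈ S := ⟨le_sup_right, hT, fun v => by have := hF v; omega⟩
  obtain ⟨H, ⟨hle, hconn, hub⟩, hmax⟩ :=
    (Set.toFinite S).exists_maximalFor (fun H => H ⊓ F) S ⟨T, hTS⟩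
  refine ⟨H, hle, hconn, fun x => ⟨?_, hub x⟩⟩
  by_contra! hx
  have hHx : 0 < H.degree x := hconn.preconnected.degree_pos_of_nontrivial x
  obtain ⟨u, hFu, hHu⟩ : ∃ u, F.Adj x u ∧ ¬ H.Adj x u := by
    by_contra! hsub
    refine absurd (Finset.card_le_card (?_ : F.neighborFinset x ⊆ H.neighborFinset x)) ?_
    · intro w hw
      simpa using hsub w (by simpa using hw)
    · simpa using hx
  have hxu := hFu.ne
  obtain ⟨K, hKdef⟩ : ∃ K, K = H ⊔ edge x u := ⟨_, rfl⟩
  have hdeg := degree_eq_of_eq_sup_edge hxu hHu hKdef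
  have hHK : H ≤ K := hKdef ▸ le_sup_left
  have hKle : K ≤ F ⊔ T := hKdef ▸ sup_le hle (by
    intro a b hab
    rw [edge_adj] at hab
    have := hFu.symm
    simp only [sup_adj]
    grind)
  have hKconn : K.Connected := hconn.mono hHK
  have hKxu : K.Adj x u := by simp [hKdef, edge_adj, hxu]
  by_cases hu : K.degree u + 1 ≤ F.degree u + T.degree u
  · have hKS : K ∈ S := by
      refine ⟨hKle, hKconn, fun v => ?_⟩
      have h1 := hdeg v
      have h2 := hub v
      have h3 := hTpos x
      by_cases hvx : v = x
      · subst hvx; simp at h1; omega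
      by_cases hvu : v = u
      · subst hvu; exact hu
      · simp [hvx, hvu] at h1; omega
    have h1 : K ⊓ F ≤ H ⊓ F := hmax hKS (inf_le_inf_right F hHK)
    exact hHu (h1 (show (K ⊓ F).Adj x u from ⟨hKxu, hFu⟩)).1
  · have hTu : ¬ T.Adj x u := fun hT' =>
      not_adj_and_adj_of_degree_add_le hKle (by omega) x ⟨hFu.symm, hT'.symm⟩
    have hFu1 := hpend x u hFu hTu (by omega)
    obtain ⟨y, hyx, hHuy, hconn'⟩ := hconn.exists_connected_deleteEdges_sup_edge hxu hHu
    rw [← hKdef] at hconn'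
    have hFuy : ¬ F.Adj u y := fun hFuy => hyx <|
      Finset.card_le_one.mp hFu1 y (by simpa using hFuy) x (by simpa using hFu.symm)
    obtain ⟨K', hK'def⟩ : ∃ K', K' = K.deleteEdges {s(u, y)} := ⟨_, rfl⟩
    rw [← hK'def] at hconn'
    have hdeg' := degree_eq_of_eq_deleteEdges (hHK hHuy) hK'def
    have hKS : K' ∈ S := by
      refine ⟨hK'def ▸ (deleteEdges_le _).trans hKle, hconn', fun v => ?_⟩
      have h0 := hdeg v
      have h1 := hdeg' v
      have h2 := hub v
      have h3 := hTpos x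
      by_cases hvx : v = x
      · subst hvx; simp at h0; omega
      by_cases hvu : v = u
      · subst hvu; simp at h0 h1; omega
      · simp [hvx, hvu] at h0; omega
    have hmono : H ⊓ F ≤ K' ⊓ F := by
      intro a b hab
      refine ⟨?_, hab.2⟩
      rw [hK'def, deleteEdges_adj]
      refine ⟨hHK hab.1, ?_⟩
      have h1 := hab.2
      have h2 := hab.2.symm
      simp only [Set.mem_singleton_iff, Sym2.eq_iff]
      rintro (⟨rfl, rfl⟩ | ⟨rfl, rfl⟩)
      · exact hFuy h1
      · exact hFuy h2
    have h1 : K' ⊓ F ≤ H ⊓ F := hmax hKS hmono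
    refine hHu (h1 (show (K' ⊓ F).Adj x u from ⟨?_, hFu⟩)).1
    rw [hK'def, deleteEdges_adj]
    refine ⟨hKxu, ?_⟩
    simp only [Set.mem_singleton_iff, Sym2.eq_iff]
    grind

/-- If `T` is connected and `F` has no isolated vertex, then `F ⊔ T` has a connected spanning
subgraph `H` with `F.degree v ≤ H.degree v ≤ F.degree v + T.degree v - 1` for every `v`. -/
theorem Connected.exists_connected_degree_bounds [Fintype V] [Nontrivial V]
    {T : SimpleGraph V} (hT : T.Connected) (F : SimpleGraph V) (hF : ∀ v, 1 ≤ F.degree v) :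
    ∃ H ≤ F ⊔ T, H.Connected ∧
      ∀ v, F.degree v ≤ H.degree v ∧ H.degree v + 1 ≤ F.degree v + T.degree v := by
  induction F using WellFoundedLT.induction with
  | ind F ih =>
    by_cases hpend : ∀ x u, F.Adj x u → ¬ T.Adj x u → 2 ≤ F.degree x → F.degree u ≤ 1
    · exact hT.exists_connected_degree_bounds_of_pendant hF hpend
    push Not at hpend
    obtain ⟨x, u, hFxu, hTxu, hx, hu⟩ := hpend
    obtain ⟨F', hF'def⟩ : ∃ F', F' = F.deleteEdges {s(x, u)} := ⟨_, rfl⟩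
    have hdeg := degree_eq_of_eq_deleteEdges hFxu hF'def
    have hF'le : F' ≤ F := hF'def ▸ deleteEdges_le _
    have hF'xu : ¬ F'.Adj x u := by simp [hF'def]
    have hlt : F' < F := lt_of_le_of_ne hF'le fun h => hF'xu (h ▸ hFxu)
    obtain ⟨H, hle, hconn, hH⟩ := ih F' hlt fun v => by
      have h1 := hdeg v
      have h2 := hF v
      by_cases hvx : v = x
      · subst hvx; simp at h1; omega
      by_cases hvu : v = u
      · subst hvu; simp at h1; omega
      · simp [hvx, hvu] at h1; omega
    have hHxu : ¬ H.Adj x u := fun h => by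
      have := hle h
      simp [hTxu, hF'xu] at this
    obtain ⟨K, hKdef⟩ : ∃ K, K = H ⊔ edge x u := ⟨_, rfl⟩
    refine ⟨K, hKdef ▸ sup_le (hle.trans (sup_le_sup_right hF'le _)) ?_,
      hconn.mono (hKdef ▸ le_sup_left), fun v => ?_⟩
    · intro a b hab
      rw [edge_adj] at hab
      have := hFxu.symm
      simp only [sup_adj]
      grind
    · have h1 := hdeg v
      have h2 := degree_eq_of_eq_sup_edge hFxu.ne hHxu hKdef v
      have h3 := hH v
      omega

end SimpleGraph

/-- Tokuda–Xu–Wang: if `G` has a `(g,f)`-factor (with `1 ≤ g ≤ f`) and a spanning `f'`-tree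
(with `f' ≥ 1`), then `G` has a connected `(g, f + f' - 1)`-factor. -/
theorem connected_factor_of_spanning_tree {V : Type*} [Fintype V]
    (G : SimpleGraph V) (g f f' : V → ℤ)
    (hg1 : ∀ v, 1 ≤ g v) (hgf : ∀ v, g v ≤ f v) (hf'1 : ∀ v, 1 ≤ f' v)
    (F : SimpleGraph V) (hFG : F ≤ G)
    (hFdeg : ∀ v, g v ≤ (F.degree v : ℤ) ∧ (F.degree v : ℤ) ≤ f v)
    (T : SimpleGraph V) (hTG : T ≤ G) (hT : T.IsTree)
    (hTdeg : ∀ v, (T.degree v : ℤ) ≤ f' v) :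
    ∃ H : SimpleGraph V, H ≤ G ∧ H.Connected ∧
      ∀ v, g v ≤ (H.degree v : ℤ) ∧ (H.degree v : ℤ) ≤ f v + f' v - 1 := by
  have hF : ∀ v, 1 ≤ F.degree v := fun v => by
    have h1 := hg1 v
    have h2 := (hFdeg v).1
    omega
  obtain ⟨v⟩ := hT.connected.nonempty
  obtain ⟨w, hvw⟩ := (F.degree_pos_iff_exists_adj v).mp (hF v)
  have : Nontrivial V := ⟨v, w, hvw.ne⟩
  obtain ⟨H, hle, hconn, hH⟩ := hT.connected.exists_connected_degree_bounds F hF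
  refine ⟨H, hle.trans (sup_le hFG hTG), hconn, fun v => ?_⟩
  have h1 := hFdeg v
  have h2 := hTdeg v
  have h3 := hH v
  omega
end

section
/- Let m be a positive integer, let G be a finite simple graph, and let g, f, f' be nonnegative integer-valued functions on V(G) with g(v) ≤ f(v), m ≤ f(v), and m ≤ f'(v) for every vertex v. If G contains a spanning subgraph F with g(v) ≤ deg_F(v) ≤ f(v) for every vertex v, and G contains a spanning subgraph T that has m pairwise edge-disjoint spanning trees and satisfies m ≤ deg_T(v) ≤ f'(v) for every vertex v, then G contains a spanning subgraph H that has m pairwise edge-disjoint spanning trees and satisfies g(v) ≤ deg_H(v) ≤ f(v) + f'(v) − m for every vertex v. -/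
open scoped Classical

/-- A graph is `m`-tree-connected if it has `m` pairwise edge-disjoint spanning trees. -/
def SimpleGraph.TreeConnected {V : Type*} (G : SimpleGraph V) (m : ℕ) : Prop :=
  ∃ T : Fin m → SimpleGraph V,
    (∀ i, T i ≤ G ∧ (T i).IsTree) ∧
    ∀ i j, i ≠ j → Disjoint (T i).edgeSet (T j).edgeSet

namespace SimpleGraph

variable {V : Type*}

lemma degree_eq_ncard_neighborSet (G : SimpleGraph V) (v : V) [Fintype (G.neighborSet v)] :
    G.degree v = (G.neighborSet v).ncard := by
  rw [Set.ncard_eq_toFinset_card']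
  rfl

/-- In a connected graph `P`, a non-edge `ab` can be exchanged for some edge at `a`. -/
lemma Connected.exists_exchange {P : SimpleGraph V} (hP : P.Connected) {a b : V} (hab : a ≠ b)
    (hn : ¬ P.Adj a b) :
    ∃ w, P.Adj a w ∧ w ≠ b ∧ (P.deleteEdges {s(a, w)} ⊔ edge a b).Connected := by
  obtain ⟨p, hp⟩ := (hP.preconnected a b).exists_isPath
  cases p with
  | nil => exact absurd rfl hab
  | @cons _ w _ h q =>
    rw [Walk.cons_isPath_iff] at hp
    have hwb : w ≠ b := by
      rintro rfl
      exact hn h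
    refine ⟨w, h, hwb, ?_⟩
    set P' := P.deleteEdges {s(a, w)} ⊔ edge a b with hP'
    have hq : ∀ e ∈ q.edges, e ∈ P'.edgeSet := by
      intro e he
      induction e with
      | h x y =>
        have hxy := q.adj_of_mem_edges he
        have hx := q.fst_mem_support_of_mem_edges he
        have hy := q.snd_mem_support_of_mem_edges he
        have hne : s(x, y) ≠ s(a, w) := by
          intro h'
          rw [Sym2.eq_iff] at h'
          rcases h' with ⟨rfl, -⟩ | ⟨-, rfl⟩
          · exact hp.2 hx
          · exact hp.2 hy
        rw [mem_edgeSet, hP', sup_adj, deleteEdges_adj]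
        exact Or.inl ⟨hxy, hne⟩
    have hwb' : P'.Reachable w b := ⟨q.transfer P' hq⟩
    have hab' : P'.Reachable a b := by
      apply Adj.reachable
      rw [hP', sup_adj, edge_adj]
      exact Or.inr ⟨Or.inl ⟨rfl, rfl⟩, hab⟩
    have haw : P'.Reachable a w := hab'.trans hwb'.symm
    have hadj : ∀ x y, P.Adj x y → P'.Reachable x y := by
      intro x y hxy
      by_cases h' : s(x, y) = s(a, w)
      · rw [Sym2.eq_iff] at h'
        rcases h' with ⟨rfl, rfl⟩ | ⟨rfl, rfl⟩
        · exact haw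
        · exact haw.symm
      · apply Adj.reachable
        rw [hP', sup_adj, deleteEdges_adj]
        exact Or.inl ⟨hxy, h'⟩
    have hwalk : ∀ x y, P.Walk x y → P'.Reachable x y := by
      intro x y r
      induction r with
      | nil => exact Reachable.refl _
      | cons h _ ih => exact (hadj _ _ h).trans ih
    have := hP.nonempty
    exact ⟨fun x y => (hP.preconnected x y).elim (hwalk x y)⟩

/-- A graph whose degrees are at least `l` has a spanning subgraph with the same property in which
every edge has an end of degree exactly `l`. -/
lemma exists_minimal_degree_ge [Finite V] (F : SimpleGraph V) (l : V → ℕ)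
    (hl : ∀ v, l v ≤ (F.neighborSet v).ncard) :
    ∃ F₁ ≤ F, (∀ v, l v ≤ (F₁.neighborSet v).ncard) ∧
      ∀ u v, F₁.Adj u v → (F₁.neighborSet u).ncard = l u ∨ (F₁.neighborSet v).ncard = l v := by
  obtain ⟨F₁, hle, hmin⟩ := exists_minimal_le_of_wellFoundedLT
    (fun H : SimpleGraph V => ∀ v, l v ≤ (H.neighborSet v).ncard) F hl
  refine ⟨F₁, hle, hmin.prop, fun u v huv => ?_⟩
  by_contra! hne
  have hu := lt_of_le_of_ne (hmin.prop u) hne.1.symm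
  have hv := lt_of_le_of_ne (hmin.prop v) hne.2.symm
  have key : ∀ x, l x ≤ ((F₁.deleteEdges {s(u, v)}).neighborSet x).ncard := by
    intro x
    by_cases hxu : x = u
    · subst hxu
      have : F₁.neighborSet x \ {v} ⊆ (F₁.deleteEdges {s(x, v)}).neighborSet x := by
        rintro y ⟨hy, hyv⟩
        simp only [mem_neighborSet, deleteEdges_adj, Set.mem_singleton_iff, Sym2.eq_iff] at *
        grind
      have h1 := Set.ncard_le_ncard this
      have h2 := Set.ncard_sdiff_singleton_of_mem (show v ∈ F₁.neighborSet x from huv)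
      omega
    · by_cases hxv : x = v
      · subst hxv
        have : F₁.neighborSet x \ {u} ⊆ (F₁.deleteEdges {s(u, x)}).neighborSet x := by
          rintro y ⟨hy, hyv⟩
          simp only [mem_neighborSet, deleteEdges_adj, Set.mem_singleton_iff, Sym2.eq_iff] at *
          grind
        have h1 := Set.ncard_le_ncard this
        have h2 := Set.ncard_sdiff_singleton_of_mem (show u ∈ F₁.neighborSet x from huv.symm)
        omega
      · refine (hmin.prop x).trans (Set.ncard_le_ncard ?_)
        intro y hy
        simp only [mem_neighborSet, deleteEdges_adj, Set.mem_singleton_iff, Sym2.eq_iff] at *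
        grind
  have hback := hmin.le_of_le key (deleteEdges_le _) huv
  simp [deleteEdges_adj] at hback

/-- Exchanging an edge `aw` for a non-edge `ab` raises no degree except that of `b`, which grows by
at most one. -/
lemma ncard_neighborSet_exchange_le [Finite V] (P : SimpleGraph V) {a b w : V} (haw : P.Adj a w)
    (v : V) :
    ((P.deleteEdges {s(a, w)} ⊔ edge a b).neighborSet v).ncard ≤
      (P.neighborSet v).ncard + if v = b then 1 else 0 := by
  by_cases hvb : v = b
  · have : (P.deleteEdges {s(a, w)} ⊔ edge a b).neighborSet v ⊆ insert a (P.neighborSet v) := by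
      intro y hy
      simp only [mem_neighborSet, sup_adj, deleteEdges_adj, edge_adj, Set.mem_insert_iff] at *
      grind
    rw [if_pos hvb]
    exact (Set.ncard_le_ncard this).trans (Set.ncard_insert_le _ _)
  · rw [if_neg hvb, add_zero]
    by_cases hva : v = a
    · subst hva
      have : (P.deleteEdges {s(v, w)} ⊔ edge v b).neighborSet v ⊆
          insert b (P.neighborSet v \ {w}) := by
        intro y hy
        simp only [mem_neighborSet, sup_adj, deleteEdges_adj, edge_adj, Set.mem_insert_iff,
          Set.mem_sdiff, Set.mem_singleton_iff, Sym2.eq_iff] at *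
        grind
      have h1 := (Set.ncard_le_ncard this).trans (Set.ncard_insert_le _ _)
      have h2 := Set.ncard_sdiff_singleton_add_one (show w ∈ P.neighborSet v from haw)
      omega
    · refine Set.ncard_le_ncard fun y hy => ?_
      simp only [mem_neighborSet, sup_adj, deleteEdges_adj, edge_adj] at *
      grind

/-- Starting from connected graphs `T i`, exchange edges of `T i` for edges of `C i`, keeping every
`T i` connected, until each vertex outside `A` is either incident with all its `C i`-edges
or has total degree at least `g`. -/
lemma exists_saturated_exchange [Finite V] {ι : Type*} [Fintype ι] (T C : ι → SimpleGraph V)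
    (F : SimpleGraph V) (A : V → Prop) (r g cap : V → ℕ)
    (hT : ∀ i, (T i).Connected)
    (hCA : ∀ i a b, (C i).Adj a b → ¬ A b → A a)
    (hCuniq : ∀ i a b w, A a → (C i).Adj a b → (C i).Adj a w → w = b)
    (hCfree : ∀ i a b w, A a → (C i).Adj a b → F.Adj a w → ¬ (T i).Adj a w)
    (hcap : ∀ v, r v + ∑ i, ((T i).neighborSet v).ncard ≤ cap v)
    (hgcap : ∀ v, g v ≤ cap v) :
    ∃ P : ι → SimpleGraph V, (∀ i, (P i).Connected) ∧ (∀ i, P i ≤ T i ⊔ C i) ∧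
      (∀ i, F ⊓ T i ≤ P i) ∧
      (∀ v, r v + ∑ i, ((P i).neighborSet v).ncard ≤ cap v) ∧
      ∀ v, ¬ A v → r v + ∑ i, ((P i).neighborSet v).ncard < g v →
        ∀ i w, (C i).Adj v w → (P i).Adj v w := by
  let S : Set (ι → SimpleGraph V) := {P | (∀ i, (P i).Connected) ∧ (∀ i, P i ≤ T i ⊔ C i) ∧
      (∀ i, F ⊓ T i ≤ P i) ∧ ∀ v, r v + ∑ i, ((P i).neighborSet v).ncard ≤ cap v}
  have hTS : T ∈ S := ⟨hT, fun _ => le_sup_left, fun _ => inf_le_right, hcap⟩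
  obtain ⟨P, hPS, hmax⟩ := (Set.toFinite S).exists_maximalFor
    (fun P i => P i ⊓ C i) S ⟨T, hTS⟩
  obtain ⟨h1, h2, h3, h4⟩ := id hPS
  refine ⟨P, h1, h2, h3, h4, fun b hb hlt i a hba => ?_⟩
  by_contra hn
  have hab : (C i).Adj a b := hba.symm
  have ha : A a := hCA i a b hab hb
  obtain ⟨w, haw, hwb, hconn⟩ := (h1 i).exists_exchange hab.ne (fun h => hn h.symm)
  have hawC : ¬ (C i).Adj a w := fun h => hwb (hCuniq i a b w ha hab h)
  have hawT : (T i).Adj a w := ((sup_adj _ _ _ _).1 (h2 i haw)).resolve_right hawC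
  have hawF : ¬ F.Adj a w := fun h => hCfree i a b w ha hab h hawT
  set Q := (P i).deleteEdges {s(a, w)} ⊔ edge a b with hQ
  have hedge : edge a b ≤ C i := by
    intro x y hxy
    rw [edge_adj] at hxy
    rcases hxy.1 with ⟨rfl, rfl⟩ | ⟨rfl, rfl⟩
    · exact hab
    · exact hba
  have hkeep : ∀ x y, (P i).Adj x y → s(x, y) ≠ s(a, w) → Q.Adj x y := by
    intro x y hxy hne
    rw [hQ, sup_adj, deleteEdges_adj]
    exact Or.inl ⟨hxy, hne⟩
  have hP'S : Function.update P i Q ∈ S := by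
    refine ⟨fun j => ?_, fun j => ?_, fun j => ?_, fun v => ?_⟩
    · by_cases hj : j = i
      · subst hj
        simpa using hconn
      · simpa [hj] using h1 j
    · by_cases hj : j = i
      · subst hj
        rw [Function.update_self]
        exact sup_le ((deleteEdges_le _).trans (h2 j)) (hedge.trans le_sup_right)
      · simpa [hj] using h2 j
    · by_cases hj : j = i
      · subst hj
        rw [Function.update_self]
        intro x y hxy
        refine hkeep x y (h3 j hxy) fun h => hawF ?_
        rw [← mem_edgeSet, ← h]
        exact hxy.1
      · simpa [hj] using h3 j
    · have hsum : ∑ j, ((Function.update P i Q j).neighborSet v).ncard ≤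
          ∑ j, ((P j).neighborSet v).ncard + if v = b then 1 else 0 := by
        rw [← Finset.add_sum_erase _ _ (Finset.mem_univ i),
          ← Finset.add_sum_erase _ (fun j => ((P j).neighborSet v).ncard) (Finset.mem_univ i),
          Function.update_self]
        have hQv := ncard_neighborSet_exchange_le (P i) (b := b) haw v
        rw [← hQ] at hQv
        have h' : ∑ j ∈ Finset.univ.erase i, ((Function.update P i Q j).neighborSet v).ncard =
            ∑ j ∈ Finset.univ.erase i, ((P j).neighborSet v).ncard :=
          Finset.sum_congr rfl fun j hj => by
            rw [Function.update_of_ne (Finset.ne_of_mem_erase hj)]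
        rw [h']
        omega
      have := h4 v
      have := hgcap v
      by_cases hvb : v = b
      · subst hvb
        simp only [if_true] at hsum
        omega
      · simp only [if_neg hvb] at hsum
        omega
  have hle : (fun j => P j ⊓ C j) ≤ fun j => Function.update P i Q j ⊓ C j := by
    intro j
    by_cases hj : j = i
    · subst hj
      simp only [Function.update_self]
      intro x y hxy
      refine ⟨hkeep x y hxy.1 fun h => hawC ?_, hxy.2⟩
      rw [← mem_edgeSet, ← h]
      exact hxy.2
    · simp [hj]
  have hback := hmax hP'S hle i
  simp only [Function.update_self] at hback
  have hQab : Q.Adj b a := by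
    rw [hQ, sup_adj, edge_adj]
    exact Or.inr ⟨Or.inr ⟨rfl, rfl⟩, hba.ne⟩
  exact hn (hback ⟨hQab, hba⟩).1

/-- The degree in an edge-disjoint union is the sum of the degrees. -/
lemma ncard_neighborSet_sup_iSup [Finite V] {ι : Type*} [Fintype ι] (R : SimpleGraph V)
    (P : ι → SimpleGraph V) (hR : ∀ i, Disjoint R (P i))
    (hP : ∀ i j, i ≠ j → Disjoint (P i) (P j)) (v : V) :
    ((R ⊔ ⨆ i, P i).neighborSet v).ncard =
      (R.neighborSet v).ncard + ∑ i, ((P i).neighborSet v).ncard := by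
  have hset : (R ⊔ ⨆ i, P i).neighborSet v = R.neighborSet v ∪ ⋃ i, (P i).neighborSet v := by
    ext w
    simp
  have hdisj : ∀ A B : SimpleGraph V, Disjoint A B →
      Disjoint (A.neighborSet v) (B.neighborSet v) := by
    intro A B h
    rw [Set.disjoint_left]
    intro w h1 h2
    exact (disjoint_iff_inf_le.1 h) (show (A ⊓ B).Adj v w from ⟨h1, h2⟩)
  rw [hset, Set.ncard_union_eq (Set.disjoint_iUnion_right.2 fun i => hdisj _ _ (hR i)),
    Set.ncard_iUnion_of_finite (fun i => Set.toFinite _) fun i j hij => hdisj _ _ (hP i j hij),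
    finsum_eq_sum_of_fintype]

/-- At most `|s|` members of an edge-disjoint family `T` contain an edge from `v` to `s`. -/
lemma ncard_indices_le [Finite V] {ι : Type*} (T : ι → SimpleGraph V)
    (hT : ∀ i j, i ≠ j → Disjoint (T i) (T j)) (v : V) (s : Set V) :
    {i | ∃ w ∈ s, (T i).Adj v w}.ncard ≤ (s ∩ (⨆ i, T i).neighborSet v).ncard := by
  have h : ∀ i ∈ {i | ∃ w ∈ s, (T i).Adj v w}, ∃ w, w ∈ s ∧ (T i).Adj v w := fun i hi => hi
  have : Nonempty V := ⟨v⟩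
  choose! φ hφ using h
  refine Set.ncard_le_ncard_of_injOn φ (fun i hi => ⟨(hφ i hi).1, ?_⟩) fun i hi j hj hij => ?_
  · rw [mem_neighborSet, iSup_adj]
    exact ⟨i, (hφ i hi).2⟩
  · by_contra hne
    refine (disjoint_iff_inf_le.1 (hT i j hne)) (show (T i ⊓ T j).Adj v (φ i) from ⟨?_, ?_⟩)
    · exact (hφ i hi).2
    · rw [hij]
      exact (hφ j hj).2

lemma TreeConnected.of_connected {m : ℕ} {H : SimpleGraph V} (P : Fin m → SimpleGraph V)
    (hPH : ∀ i, P i ≤ H) (hP : ∀ i, (P i).Connected)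
    (hdisj : ∀ i j, i ≠ j → Disjoint (P i) (P j)) : H.TreeConnected m := by
  choose T hTP hT using fun i => (hP i).exists_isTree_le
  refine ⟨T, fun i => ⟨(hTP i).trans (hPH i), hT i⟩, fun i j hij => ?_⟩
  rw [disjoint_edgeSet]
  exact (hdisj i j hij).mono (hTP i) (hTP j)

/-- The factor theorem with degrees counted by `Set.ncard` and degree bounds in `ℕ`. -/
lemma exists_treeConnected_factor [Finite V] {m : ℕ} (hm : 0 < m) {g f f' : V → ℕ}
    (hgf : ∀ v, g v ≤ f v) (hmf : ∀ v, m ≤ f v) (hmf' : ∀ v, m ≤ f' v) (F : SimpleGraph V)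
    (hgF : ∀ v, g v ≤ (F.neighborSet v).ncard) (hFf : ∀ v, (F.neighborSet v).ncard ≤ f v)
    (T : Fin m → SimpleGraph V) (hT : ∀ i, (T i).Connected)
    (hTdisj : ∀ i j, i ≠ j → Disjoint (T i) (T j))
    (hTf : ∀ v, ((⨆ i, T i).neighborSet v).ncard ≤ f' v) :
    ∃ H ≤ F ⊔ ⨆ i, T i, H.TreeConnected m ∧
      ∀ v, g v ≤ (H.neighborSet v).ncard ∧ (H.neighborSet v).ncard + m ≤ f v + f' v := by
  set U := ⨆ i, T i with hU
  have hTU : ∀ i, T i ≤ U := fun i => le_iSup T i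
  have hUsum : ∀ v, (U.neighborSet v).ncard = ∑ i, ((T i).neighborSet v).ncard := by
    intro v
    have := ncard_neighborSet_sup_iSup ⊥ T (fun i => disjoint_bot_left) hTdisj v
    rwa [bot_sup_eq, neighborSet_bot, Set.ncard_empty, zero_add] at this
  let l : V → ℕ := fun v =>
    ((F \ U).neighborSet v).ncard + (U.neighborSet v).ncard + m - (f v + f' v)
  have hFU : ∀ v, (F.neighborSet v ∩ U.neighborSet v).ncard + ((F \ U).neighborSet v).ncard =
      (F.neighborSet v).ncard := by
    intro v
    rw [← Set.ncard_inter_add_ncard_sdiff_eq_ncard (F.neighborSet v) (U.neighborSet v)]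
    rfl
  have hl : ∀ v, l v ≤ ((F \ U).neighborSet v).ncard := by
    intro v
    have := hTf v
    have := hmf v
    simp only [l]
    omega
  obtain ⟨F₁, hF₁, hlF₁, htight⟩ := exists_minimal_degree_ge (F \ U) l hl
  let A : V → Prop := fun v => 0 < l v ∧ (F₁.neighborSet v).ncard = l v
  have hA : ∀ u v, F₁.Adj u v → A u ∨ A v := by
    intro u v huv
    have hpos : ∀ x y, F₁.Adj x y → 0 < (F₁.neighborSet x).ncard := fun x y hxy =>
      (Set.ncard_pos (Set.toFinite _)).2 ⟨y, hxy⟩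
    exact (htight u v huv).imp (fun h => ⟨(hpos u v huv).trans_eq h, h⟩)
      fun h => ⟨(hpos v u huv.symm).trans_eq h, h⟩
  have : Nonempty (Fin m) := ⟨⟨0, hm⟩⟩
  have hcolor : ∀ a, A a → ∃ c : V → Fin m, Set.InjOn c (F₁.neighborSet a) ∧
      ∀ b, F₁.Adj a b → ∀ w, F.Adj a w → ¬ (T (c b)).Adj a w := by
    intro a ha
    have hK := ncard_indices_le T hTdisj a (F.neighborSet a)
    rw [← hU] at hK
    have hcompl := Set.ncard_add_ncard_compl {i | ∃ w ∈ F.neighborSet a, (T i).Adj a w}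
    rw [Nat.card_eq_fintype_card, Fintype.card_fin] at hcompl
    have hle : (F₁.neighborSet a).ncard ≤ {i | ∃ w ∈ F.neighborSet a, (T i).Adj a w}ᶜ.ncard := by
      have h1 := ha.1
      have h2 := ha.2
      have := hTf a
      have := hFf a
      have := hFU a
      simp only [l] at h1 h2
      omega
    obtain ⟨c, hc, hinj⟩ := (Set.toFinite (F₁.neighborSet a)).exists_injOn_of_encard_le
      (t := {i | ∃ w ∈ F.neighborSet a, (T i).Adj a w}ᶜ) (by
        rw [← (Set.toFinite _).cast_ncard_eq, ← (Set.toFinite _).cast_ncard_eq]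
        exact_mod_cast hle)
    exact ⟨c, hinj, fun b hb w hw hTw => hc hb ⟨w, hw, hTw⟩⟩
  choose! c hcinj hcfree using hcolor
  let C : Fin m → SimpleGraph V := fun i =>
    { Adj := fun u v => F₁.Adj u v ∧ ((A u ∧ ¬ A v ∧ c u v = i) ∨ (A v ∧ ¬ A u ∧ c v u = i))
      symm := ⟨fun u v h => ⟨h.1.symm, h.2.symm⟩⟩
      loopless := ⟨fun u h => F₁.irrefl h.1⟩ }
  have hCF : ∀ i, C i ≤ F₁ := fun i u v h => h.1
  have hCdisj : ∀ i j, i ≠ j → Disjoint (C i) (C j) := by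
    intro i j hij
    rw [disjoint_iff_inf_le]
    rintro u v ⟨⟨-, h1⟩, ⟨-, h2⟩⟩
    exfalso
    grind
  have hCA : ∀ i a b, A a → (C i).Adj a b → F₁.Adj a b ∧ c a b = i := by
    rintro i a b ha ⟨h, h' | h'⟩
    · exact ⟨h, h'.2.2⟩
    · exact absurd ha h'.2.1
  have hF₁U : Disjoint F₁ U := disjoint_sdiff_self_left.mono_left hF₁
  set R := (F \ U) \ F₁ with hR
  have hRF₁ : ∀ v, (R.neighborSet v).ncard + (F₁.neighborSet v).ncard =
      ((F \ U).neighborSet v).ncard := by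
    intro v
    refine Set.ncard_sdiff_add_ncard_of_subset (s := F₁.neighborSet v)
      (t := (F \ U).neighborSet v) (fun w hw => hF₁ hw)
  obtain ⟨P, hPconn, hPle, hFTP, hPcap, hPsat⟩ := exists_saturated_exchange T C F A
    (fun v => (R.neighborSet v).ncard) g (fun v => f v + f' v - m) hT
    (fun i a b h hb => (hA a b h.1).resolve_right hb)
    (fun i a b w ha hb hw => hcinj a ha (hCA i a w ha hw).1 (hCA i a b ha hb).1
      ((hCA i a w ha hw).2.trans (hCA i a b ha hb).2.symm))
    (fun i a b w ha hb hw => by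
      have := hcfree a ha b (hCA i a b ha hb).1 w hw
      rwa [(hCA i a b ha hb).2] at this)
    (fun v => by
      have h1 := hRF₁ v
      have h2 := hlF₁ v
      have := hmf v
      rw [← hUsum]
      simp only [l] at h2
      omega)
    (fun v => by
      have := hgf v
      have := hmf' v
      omega)
  have hPdisj : ∀ i j, i ≠ j → Disjoint (P i) (P j) := by
    intro i j hij
    refine Disjoint.mono (hPle i) (hPle j) ?_
    rw [disjoint_sup_left, disjoint_sup_right, disjoint_sup_right]
    exact ⟨⟨hTdisj i j hij, (hF₁U.mono (hCF j) (hTU i)).symm⟩,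
      hF₁U.mono (hCF i) (hTU j), hCdisj i j hij⟩
  have hRP : ∀ i, Disjoint R (P i) := by
    intro i
    refine Disjoint.mono_right (hPle i) ?_
    rw [disjoint_sup_right]
    exact ⟨(disjoint_sdiff_self_left.mono_right (hTU i)).mono_left sdiff_le,
      disjoint_sdiff_self_left.mono_right (hCF i)⟩
  have hdeg := ncard_neighborSet_sup_iSup R P hRP hPdisj
  refine ⟨R ⊔ ⨆ i, P i, ?_, TreeConnected.of_connected P
    (fun i => (le_iSup P i).trans le_sup_right) hPconn hPdisj, fun v => ⟨?_, ?_⟩⟩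
  · refine sup_le ((sdiff_le.trans sdiff_le).trans le_sup_left) (iSup_le fun i => ?_)
    exact (hPle i).trans (sup_le ((hTU i).trans le_sup_right)
      (((hCF i).trans (hF₁.trans sdiff_le)).trans le_sup_left))
  · by_cases hv : A v
    · have hmP : m ≤ ∑ i, ((P i).neighborSet v).ncard := by
        obtain ⟨w, hw⟩ := (Set.ncard_pos (Set.toFinite _)).1 (hv.2 ▸ hv.1)
        have : Nontrivial V := ⟨v, w, F₁.ne_of_adj hw⟩
        have h1 : ∀ i, 1 ≤ ((P i).neighborSet v).ncard := fun i =>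
          (Set.ncard_pos (Set.toFinite _)).2 ((hPconn i).preconnected.exists_adj_of_nontrivial v)
        calc m = ∑ _i : Fin m, 1 := by simp
          _ ≤ _ := Finset.sum_le_sum fun i _ => h1 i
      have h1 := hv.1
      have h2 := hv.2
      have := hRF₁ v
      have := hFU v
      have := hFf v
      have := hTf v
      have := hgF v
      rw [hdeg]
      simp only [l] at h1 h2
      omega
    · by_contra! hlt
      have hsat := hPsat v hv (by rwa [hdeg] at hlt)
      refine absurd (hgF v) (not_le.2 (lt_of_le_of_lt (Set.ncard_le_ncard fun w hw => ?_) hlt))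
      rw [mem_neighborSet, sup_adj, iSup_adj]
      by_cases hUw : U.Adj v w
      · rw [hU, iSup_adj] at hUw
        obtain ⟨i, hi⟩ := hUw
        exact Or.inr ⟨i, hFTP i ⟨hw, hi⟩⟩
      · by_cases h1 : F₁.Adj v w
        · exact Or.inr ⟨c w v, hsat _ w ⟨h1, Or.inr ⟨(hA v w h1).resolve_left hv, hv, rfl⟩⟩⟩
        · exact Or.inl ⟨⟨hw, hUw⟩, h1⟩
  · have := hPcap v
    have := hmf v
    rw [hdeg]
    omega

end SimpleGraph

/-- If `G` contains a `(g,f)`-factor and an `m`-tree-connected `(m,f')`-factor, then it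
contains an `m`-tree-connected `(g, f + f' - m)`-factor. -/
theorem treeConnected_factor_of_factors {V : Type*} [Fintype V]
    (m : ℕ) (hm : 0 < m) (G : SimpleGraph V) (g f f' : V → ℤ)
    (hg0 : ∀ v, 0 ≤ g v) (hf0 : ∀ v, 0 ≤ f v) (hf'0 : ∀ v, 0 ≤ f' v)
    (hgf : ∀ v, g v ≤ f v) (hmf : ∀ v, (m : ℤ) ≤ f v) (hmf' : ∀ v, (m : ℤ) ≤ f' v)
    (F : SimpleGraph V) (hFG : F ≤ G)
    (hFdeg : ∀ v, g v ≤ (F.degree v : ℤ) ∧ (F.degree v : ℤ) ≤ f v)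
    (T : SimpleGraph V) (hTG : T ≤ G) (hT : T.TreeConnected m)
    (hTdeg : ∀ v, (m : ℤ) ≤ (T.degree v : ℤ) ∧ (T.degree v : ℤ) ≤ f' v) :
    ∃ H : SimpleGraph V, H ≤ G ∧ H.TreeConnected m ∧
      ∀ v, g v ≤ (H.degree v : ℤ) ∧ (H.degree v : ℤ) ≤ f v + f' v - m := by
  lift g to V → ℕ using hg0
  lift f to V → ℕ using hf0
  lift f' to V → ℕ using hf'0
  simp only [SimpleGraph.degree_eq_ncard_neighborSet, Nat.cast_le] at *
  obtain ⟨P, hP, hPdisj⟩ := hT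
  have hPT : ⨆ i, P i ≤ T := iSup_le fun i => (hP i).1
  obtain ⟨H, hH, hHm, hHdeg⟩ := SimpleGraph.exists_treeConnected_factor hm hgf hmf hmf' F
    (fun v => (hFdeg v).1) (fun v => (hFdeg v).2) P (fun i => (hP i).2.connected)
    (fun i j hij => SimpleGraph.disjoint_edgeSet.1 (hPdisj i j hij))
    (fun v => (Set.ncard_le_ncard fun _ hw => hPT hw).trans (hTdeg v).2)
  refine ⟨H, hH.trans (sup_le hFG (hPT.trans hTG)), hHm, fun v => ⟨(hHdeg v).1, ?_⟩⟩
  have := (hHdeg v).2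
  omega
end

section
/- Let G be a finite simple graph with a spanning subgraph F, and let M be a matching of F containing exactly one edge from each component of F that has at least one edge, such that each chosen edge is incident to a vertex that is not a cut vertex of F. If T is a spanning tree of G, then G has a connected spanning subgraph H whose edge set contains E(F) \ E(M) and such that for every vertex v, deg_F(v) ≤ deg_H(v) ≤ deg_T(v) + max{0, deg_F(v) − 1}. -/
open scoped Classical

/-- `v` is a cut vertex of `F` if removing `v` from `F` increases the number of
connected components. -/
def SimpleGraph.IsCutVertex {V : Type*} (F : SimpleGraph V) (v : V) : Prop :=
  Nat.card F.ConnectedComponent <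
    Nat.card (SimpleGraph.induce {w : V | w ≠ v} F).ConnectedComponent

namespace SimpleGraph

variable {V : Type*}

/-- The spanning subgraph of `F` whose edges are those with both ends in `A`. -/
def edgesWithin (F : SimpleGraph V) (A : Set V) : SimpleGraph V where
  Adj a b := F.Adj a b ∧ a ∈ A ∧ b ∈ A
  symm := ⟨fun _ _ h => ⟨h.1.symm, h.2.2, h.2.1⟩⟩
  loopless := ⟨fun _ h => F.loopless.irrefl _ h.1⟩

/-- The graph obtained from `F` by deleting the edges of `M` that do not lie within `A`. -/
def deleteOutside (F M : SimpleGraph V) (A : Set V) : SimpleGraph V where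
  Adj a b := F.Adj a b ∧ (M.Adj a b → a ∈ A ∧ b ∈ A)
  symm := ⟨fun _ _ h => ⟨h.1.symm, fun hM => (h.2 hM.symm).symm⟩⟩
  loopless := ⟨fun _ h => F.loopless.irrefl _ h.1⟩

theorem Reachable.of_adj_closed {K : SimpleGraph V} {P : V → Prop}
    (hP : ∀ a b, K.Adj a b → P a → P b) {a b : V} (hab : K.Reachable a b) (ha : P a) : P b := by
  obtain ⟨p⟩ := hab
  induction p with
  | nil => exact ha
  | cons h _ ih => exact ih (hP _ _ h ha)

theorem Connected.of_adj_reachable {K L : SimpleGraph V} (hK : K.Connected)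
    (h : ∀ a b, K.Adj a b → L.Reachable a b) : L.Connected := by
  have := hK.nonempty
  refine Connected.mk fun a b => ?_
  exact (hK.preconnected a b).of_adj_closed (P := fun c => L.Reachable a c)
    (fun c d hcd hc => hc.trans (h c d hcd)) (Reachable.refl a)

/-- In a connected graph, some edge at `v` can be exchanged for an edge from `v` to `u`. -/
theorem Connected.exists_exchange_s3 {K : SimpleGraph V} (hK : K.Connected) {v u : V} (hvu : v ≠ u) :
    ∃ w, K.Adj v w ∧ ∀ L : SimpleGraph V, K.deleteEdges {s(v, w)} ≤ L → L.Adj v u →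
      L.Connected := by
  obtain ⟨p, hp⟩ := (hK.preconnected v u).exists_isPath
  cases p with
  | nil => exact absurd rfl hvu
  | @cons _ w _ h q =>
    rw [Walk.cons_isPath_iff] at hp
    refine ⟨w, h, fun L hL hLvu => hK.of_adj_reachable ?_⟩
    have hq : (K.deleteEdges {s(v, w)}).Reachable w u :=
      ⟨q.toDeleteEdge s(v, w) fun he => hp.2 (q.fst_mem_support_of_mem_edges he)⟩
    have hvw : L.Reachable v w := hLvu.reachable.trans (hq.mono hL).symm
    intro a b hab
    by_cases he : s(a, b) = s(v, w)
    · rcases Sym2.eq_iff.1 he with ⟨rfl, rfl⟩ | ⟨rfl, rfl⟩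
      · exact hvw
      · exact hvw.symm
    · exact (hL (by simpa [deleteEdges_adj, hab] using he)).reachable

/-- Two vertices of one component stay connected after removing a non-cut vertex that is not
isolated. -/
theorem reachable_induce_of_not_isCutVertex [Finite V] {F : SimpleGraph V} {x y : V}
    (hx : ¬ F.IsCutVertex x) (hxy : F.Adj x y) {a b : V} (ha : a ≠ x) (hb : b ≠ x)
    (hab : F.Reachable a b) :
    (induce {w : V | w ≠ x} F).Reachable ⟨a, ha⟩ ⟨b, hb⟩ := by
  let φ : (induce {w : V | w ≠ x} F).ConnectedComponent → F.ConnectedComponent :=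
    ConnectedComponent.map (Embedding.induce {w : V | w ≠ x}).toHom
  have hφ : Function.Surjective φ := by
    intro C
    induction C using ConnectedComponent.ind with | _ v => ?_
    by_cases hv : v = x
    · subst hv
      exact ⟨connectedComponentMk _ ⟨y, hxy.ne'⟩, ConnectedComponent.sound hxy.symm.reachable⟩
    · exact ⟨connectedComponentMk _ ⟨v, hv⟩, rfl⟩
  have hinj := (hφ.bijective_of_nat_card_le (not_lt.1 hx)).1
  exact ConnectedComponent.exact (hinj (ConnectedComponent.sound hab :
    φ (connectedComponentMk _ ⟨a, ha⟩) = φ (connectedComponentMk _ ⟨b, hb⟩)))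

section Degree

variable {H K L : SimpleGraph V} {v : V} [Fintype (H.neighborSet v)]
  [Fintype (K.neighborSet v)] [Fintype (L.neighborSet v)]

theorem degree_le_add_of_adj (h : ∀ w, H.Adj v w → K.Adj v w ∨ L.Adj v w) :
    H.degree v ≤ K.degree v + L.degree v := by
  simp only [← card_neighborFinset_eq_degree]
  refine (Finset.card_le_card fun w hw => ?_).trans (Finset.card_union_le _ _)
  simpa using h w (by simpa using hw)

theorem degree_le_of_adj (h : ∀ w, H.Adj v w → K.Adj v w) : H.degree v ≤ K.degree v := by
  simp only [← card_neighborFinset_eq_degree]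
  exact Finset.card_le_card fun w hw => by simpa using h w (by simpa using hw)

theorem degree_lt_of_adj (h : ∀ w, H.Adj v w → K.Adj v w)
    (hlt : ∃ w, K.Adj v w ∧ ¬ H.Adj v w) : H.degree v < K.degree v := by
  obtain ⟨w, hw, hw'⟩ := hlt
  simp only [← card_neighborFinset_eq_degree]
  refine Finset.card_lt_card ((Finset.ssubset_iff_of_subset fun w hw => ?_).2 ⟨w, ?_, ?_⟩)
  · simpa using h w (by simpa using hw)
  · simpa using hw
  · simpa using hw'

theorem degree_le_of_exchange {w u : V} (h : ∀ z, z ≠ w → H.Adj v z → K.Adj v z)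
    (hw : H.Adj v w) (hu : K.Adj v u) (hu' : ¬ H.Adj v u) : H.degree v ≤ K.degree v := by
  simp only [← card_neighborFinset_eq_degree]
  have hsub : insert u ((H.neighborFinset v).erase w) ⊆ K.neighborFinset v := by
    intro z hz
    rw [Finset.mem_insert, Finset.mem_erase, mem_neighborFinset] at hz
    rw [mem_neighborFinset]
    rcases hz with rfl | hz
    · exact hu
    · exact h z hz.1 hz.2
  have hcard := Finset.card_le_card hsub
  rw [Finset.card_insert_of_notMem (by simp [hu']),
    Finset.card_erase_of_mem (by simpa using hw)] at hcard
  have : 0 < (H.neighborFinset v).card := Finset.card_pos.2 ⟨w, by simpa using hw⟩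
  omega

end Degree

/-- `A` contains every vertex `r C`, the graph `T' ≤ T` together with the edges of `F` within `A`
is connected, and `T'` misses an edge of `T` at every vertex of `A` other than the `r C`, as well
as at `r C` if `Q C` holds and `x C` is in `A`. -/
structure IsAbsorbing (F T : SimpleGraph V) (r x : F.ConnectedComponent → V)
    (Q : F.ConnectedComponent → Prop) (A : Set V) (T' : SimpleGraph V) : Prop where
  le : T' ≤ T
  connected : (T' ⊔ F.edgesWithin A).Connected
  root_mem : ∀ C, r C ∈ A
  exists_missing : ∀ v ∈ A, (∀ C, v ≠ r C) → ∃ w, T.Adj v w ∧ ¬ T'.Adj v w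
  exists_missing_root : ∀ C, Q C → x C ∈ A → ∃ w, T.Adj (r C) w ∧ ¬ T'.Adj (r C) w

section Absorbing

variable {F T : SimpleGraph V} {r x : F.ConnectedComponent → V} {Q : F.ConnectedComponent → Prop}

theorem exists_maximal_isAbsorbing [Finite V] {A₀ : Set V} {T₀ : SimpleGraph V}
    (h₀ : F.IsAbsorbing T r x Q A₀ T₀) :
    ∃ A T', F.IsAbsorbing T r x Q A T' ∧
      ∀ B T'', A ⊆ B → T'' ≤ T' → F.IsAbsorbing T r x Q B T'' → B ⊆ A ∧ T' ≤ T'' := by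
  let s : Set (Set V × (SimpleGraph V)ᵒᵈ) :=
    {p | F.IsAbsorbing T r x Q p.1 (OrderDual.ofDual p.2)}
  obtain ⟨p, hp⟩ := s.toFinite.exists_maximal ⟨(A₀, OrderDual.toDual T₀), h₀⟩
  refine ⟨p.1, OrderDual.ofDual p.2, hp.prop, fun B T'' hB hT hBT => ?_⟩
  have := hp.le_of_ge (y := (B, OrderDual.toDual T'')) hBT ⟨hB, hT⟩
  exact ⟨this.1, this.2⟩

variable {T' : SimpleGraph V} {A : Set V}

/-- A vertex outside `A` with a neighbour in `A` can be absorbed by giving up an edge of `T'`. -/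
theorem IsAbsorbing.exists_insert (h : F.IsAbsorbing T r x Q A T') {v u : V} (hv : v ∉ A)
    (hu : u ∈ A) (hvu : F.Adj v u)
    (hroot : ∀ C, Q C → x C = v → ∃ w, T.Adj (r C) w ∧ ¬ T'.Adj (r C) w) :
    ∃ T'' ≤ T', F.IsAbsorbing T r x Q (insert v A) T'' := by
  obtain ⟨w, hw, hconn⟩ := h.connected.exists_exchange_s3 hvu.ne
  have hw' : T'.Adj v w := hw.resolve_right fun hF => hv hF.2.1
  have hle : T'.deleteEdges {s(v, w)} ≤ T' := deleteEdges_le _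
  refine ⟨_, hle, hle.trans h.le, hconn _ ?_ ?_, fun C => Or.inr (h.root_mem C), ?_, ?_⟩
  · intro a b hab
    rw [deleteEdges_adj] at hab
    rcases hab.1 with hT | hF
    · exact Or.inl (deleteEdges_adj.2 ⟨hT, hab.2⟩)
    · exact Or.inr ⟨hF.1, Or.inr hF.2.1, Or.inr hF.2.2⟩
  · exact Or.inr ⟨hvu, Or.inl rfl, Or.inr hu⟩
  · rintro a (rfl | ha) har
    · exact ⟨w, h.le hw', fun hd => (deleteEdges_adj.1 hd).2 rfl⟩
    · obtain ⟨z, hz, hz'⟩ := h.exists_missing a ha har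
      exact ⟨z, hz, fun hd => hz' (hle hd)⟩
  · intro C hQ hx
    obtain ⟨z, hz, hz'⟩ := hx.elim (hroot C hQ) (h.exists_missing_root C hQ)
    exact ⟨z, hz, fun hd => hz' (hle hd)⟩

/-- An edge of `T'` whose ends are joined by edges of `F` within `A` can be given up. -/
theorem IsAbsorbing.deleteEdges (h : F.IsAbsorbing T r x Q A T') {a b : V}
    (hab : (F.edgesWithin A).Reachable a b) :
    F.IsAbsorbing T r x Q A (T'.deleteEdges {s(a, b)}) := by
  have hle : T'.deleteEdges {s(a, b)} ≤ T' := deleteEdges_le _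
  refine ⟨hle.trans h.le, h.connected.of_adj_reachable ?_, h.root_mem, ?_, ?_⟩
  · have hab' := hab.mono (le_sup_right (a := T'.deleteEdges {s(a, b)}))
    rintro c d (hT | hF)
    · by_cases he : s(c, d) = s(a, b)
      · rcases Sym2.eq_iff.1 he with ⟨rfl, rfl⟩ | ⟨rfl, rfl⟩
        · exact hab'
        · exact hab'.symm
      · exact Adj.reachable (Or.inl (deleteEdges_adj.2 ⟨hT, he⟩))
    · exact Adj.reachable (Or.inr hF)
  · intro v hv hvr
    obtain ⟨z, hz, hz'⟩ := h.exists_missing v hv hvr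
    exact ⟨z, hz, fun hd => hz' (hle hd)⟩
  · intro C hQ hx
    obtain ⟨z, hz, hz'⟩ := h.exists_missing_root C hQ hx
    exact ⟨z, hz, fun hd => hz' (hle hd)⟩

end Absorbing

end SimpleGraph

/-- Let `M` be a matching of a spanning subgraph `F` of `G` having exactly one edge of
every non-trivial component of `F`, each such edge being incident to a non-cut vertex
of `F`.  If `T` is a spanning tree of `G`, then `G` has a connected spanning subgraph
`H` containing `E(F) \ E(M)` with
`deg_F(v) ≤ deg_H(v) ≤ deg_T(v) + max {0, deg_F(v) - 1}` for every vertex `v`. -/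
theorem connected_factor_of_matching_tree {V : Type*} [Fintype V]
    (G : SimpleGraph V) (F : SimpleGraph V) (hFG : F ≤ G)
    (M : SimpleGraph V) (hMF : M ≤ F)
    (hmatching : ∀ v w w' : V, M.Adj v w → M.Adj v w' → w = w')
    (hone : ∀ C : F.ConnectedComponent,
      (∃ v w : V, F.Adj v w ∧ F.connectedComponentMk v = C) →
      ∃! e : Sym2 V, e ∈ M.edgeSet ∧ ∀ v ∈ e, F.connectedComponentMk v = C)
    (hcut : ∀ e ∈ M.edgeSet, ∃ v ∈ e, ¬ F.IsCutVertex v)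
    (T : SimpleGraph V) (hTG : T ≤ G) (hT : T.IsTree) :
    ∃ H : SimpleGraph V, H ≤ G ∧ H.Connected ∧
      F.edgeSet \ M.edgeSet ⊆ H.edgeSet ∧
      ∀ v, F.degree v ≤ H.degree v ∧
        (H.degree v : ℤ) ≤ (T.degree v : ℤ) + max 0 ((F.degree v : ℤ) - 1) := by
  have hroots : ∀ C : F.ConnectedComponent, ∃ r x, F.connectedComponentMk r = C ∧
      ((∃ w, F.connectedComponentMk w = C ∧ T.Adj r w) ∨ (∀ w, ¬ F.Adj r w) ∨
        (M.Adj x r ∧ ¬ F.IsCutVertex x ∧ ∀ a b, F.connectedComponentMk a = C →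
          F.connectedComponentMk b = C → ¬ T.Adj a b)) := by
    intro C
    by_cases h1 : ∃ a b, F.connectedComponentMk a = C ∧ F.connectedComponentMk b = C ∧ T.Adj a b
    · obtain ⟨a, b, ha, hb, hab⟩ := h1
      exact ⟨a, a, ha, Or.inl ⟨b, hb, hab⟩⟩
    by_cases h2 : ∃ v w : V, F.Adj v w ∧ F.connectedComponentMk v = C
    · obtain ⟨e, ⟨he, heC⟩, -⟩ := hone C h2
      obtain ⟨x, hxe, hx⟩ := hcut e he
      obtain ⟨y, rfl⟩ := Sym2.mem_iff_exists.1 hxe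
      exact ⟨y, x, heC y (Sym2.mem_mk_right _ _), Or.inr (Or.inr ⟨he, hx, fun a b ha hb hab =>
        h1 ⟨a, b, ha, hb, hab⟩⟩)⟩
    · obtain ⟨v, rfl⟩ := C.exists_rep
      exact ⟨v, v, rfl, Or.inr (Or.inl fun w hw => h2 ⟨v, w, hw, rfl⟩)⟩
  choose r x hrC hr using hroots
  let Q : F.ConnectedComponent → Prop := fun C => M.Adj (x C) (r C) ∧ ¬ F.IsCutVertex (x C) ∧
    ∀ a b, F.connectedComponentMk a = C → F.connectedComponentMk b = C → ¬ T.Adj a b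
  have hmk : ∀ {a b : V}, F.Adj a b → F.connectedComponentMk a = F.connectedComponentMk b :=
    fun h => SimpleGraph.ConnectedComponent.sound h.reachable
  have hxC : ∀ C, Q C → F.connectedComponentMk (x C) = C :=
    fun C hQ => (hmk (hMF hQ.1)).trans (hrC C)
  have hxr : ∀ C, Q C → ∀ D, x C ≠ r D := by
    intro C hQ D hD
    have hCD : C = D := by rw [← hxC C hQ, hD, hrC]
    subst hCD
    exact hQ.1.ne hD
  have h₀ : F.IsAbsorbing T r x Q (Set.range r) T := by
    refine ⟨le_rfl, hT.connected.mono le_sup_left, fun C => ⟨C, rfl⟩, ?_, ?_⟩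
    · rintro v ⟨C, rfl⟩ hv
      exact absurd rfl (hv C)
    · rintro C hQ ⟨D, hD⟩
      exact absurd hD.symm (hxr C hQ D)
  obtain ⟨A, T', hA, hmax⟩ := SimpleGraph.exists_maximal_isAbsorbing h₀
  have hbdry : ∀ v u, v ∉ A → u ∈ A → F.Adj v u → ∃ C, Q C ∧ x C = v ∧
      ∀ w, T.Adj (r C) w → T'.Adj (r C) w := by
    intro v u hv hu hvu
    by_contra! hcon
    obtain ⟨T'', hle, hT''⟩ := hA.exists_insert hv hu hvu hcon
    exact hv ((hmax _ _ (Set.subset_insert v A) hle hT'').1 (Set.mem_insert v A))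
  have hout : ∀ v, v ∉ A → ∃ C, Q C ∧ x C = v ∧ ∀ w, T.Adj (r C) w → T'.Adj (r C) w := by
    intro v hv
    by_cases hQ : Q (F.connectedComponentMk v)
    · set C := F.connectedComponentMk v with hC
      have hvx : v = x C := by
        by_contra hne
        have hreach := SimpleGraph.reachable_induce_of_not_isCutVertex hQ.2.1 (hMF hQ.1)
          hQ.1.ne' hne (SimpleGraph.ConnectedComponent.exact (hrC C))
        refine hv (hreach.of_adj_closed
          (P := fun a => a.1 ∈ A ∧ F.connectedComponentMk a.1 = C) ?_ ⟨hA.root_mem C, hrC C⟩).1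
        rintro ⟨a, ha⟩ ⟨b, hb⟩ hab ⟨haA, haC⟩
        have hab' : F.Adj a b := hab
        have hbC := (hmk hab').symm.trans haC
        refine ⟨?_, hbC⟩
        by_contra hbA
        obtain ⟨D, hD, hDb, -⟩ := hbdry b a hbA haA hab'.symm
        have hDC : D = C := by rw [← hxC D hD, hDb]; exact hbC
        exact hb (by rw [← hDC]; exact hDb.symm)
      refine hbdry v (r C) hv (hA.root_mem C) ?_
      rw [hvx]
      exact hMF hQ.1
    · exfalso
      have hreach : F.Reachable (r (F.connectedComponentMk v)) v :=
        SimpleGraph.ConnectedComponent.exact (hrC _)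
      refine hv (hreach.of_adj_closed (P := fun a => a ∈ A ∧
        F.connectedComponentMk a = F.connectedComponentMk v) ?_ ⟨hA.root_mem _, hrC _⟩).1
      rintro a b hab ⟨haA, haC⟩
      have hbC := (hmk hab).symm.trans haC
      refine ⟨?_, hbC⟩
      by_contra hbA
      obtain ⟨D, hD, hDb, -⟩ := hbdry b a hbA haA hab.symm
      apply hQ
      rwa [← hbC, ← hDb, hxC D hD]
  have hinner : ∀ C, ¬ Q C → ∀ w, F.connectedComponentMk w = C → ¬ T'.Adj (r C) w := by
    intro C hQ w hw hadj
    have hreach : F.Reachable (r C) w :=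
      SimpleGraph.ConnectedComponent.exact ((hrC C).trans hw.symm)
    have hCA : ∀ a, F.connectedComponentMk a = C → a ∈ A := by
      intro a ha
      by_contra haA
      obtain ⟨D, hD, hDa, -⟩ := hout a haA
      apply hQ
      rwa [← ha, ← hDa, hxC D hD]
    have hreach' : (F.edgesWithin A).Reachable (r C) w :=
      (hreach.of_adj_closed (P := fun a => F.connectedComponentMk a = C ∧
        (F.edgesWithin A).Reachable (r C) a) (fun a b hab ha => by
          have hb := (hmk hab).symm.trans ha.1
          have hab' : (F.edgesWithin A).Adj a b := ⟨hab, hCA a ha.1, hCA b hb⟩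
          exact ⟨hb, ha.2.trans hab'.reachable⟩)
        ⟨hrC C, SimpleGraph.Reachable.refl _⟩).2
    have := (hmax A _ subset_rfl (SimpleGraph.deleteEdges_le _) (hA.deleteEdges hreach')).2 hadj
    exact (SimpleGraph.deleteEdges_adj.1 this).2 rfl
  have hedge : ∀ C, Q C → ∀ v w, M.Adj v w → F.connectedComponentMk v = C →
      s(v, w) = s(x C, r C) := by
    intro C hQ v w hvw hv
    refine (hone C ⟨v, w, hMF hvw, hv⟩).unique ⟨hvw, ?_⟩ ⟨hQ.1, ?_⟩
    · intro z hz
      rcases Sym2.mem_iff.1 hz with rfl | rfl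
      · exact hv
      · rw [← hmk (hMF hvw)]; exact hv
    · intro z hz
      rcases Sym2.mem_iff.1 hz with rfl | rfl
      · exact hxC C hQ
      · exact hrC C
  have hnbr : ∀ v w, F.Adj v w → ∃ u, (T' ⊔ F.edgesWithin A).Adj v u := by
    intro v w hvw
    obtain ⟨u, hu, -⟩ := hA.connected.exists_exchange_s3 hvw.ne
    exact ⟨u, hu⟩
  have hTnbr : ∀ v w, F.Adj v w → ∃ u, T.Adj v u := by
    intro v w hvw
    obtain ⟨u, hu, -⟩ := hT.connected.exists_exchange_s3 hvw.ne
    exact ⟨u, hu⟩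
  obtain ⟨H, hH⟩ : ∃ H, H = T' ⊔ F.deleteOutside M A := ⟨_, rfl⟩
  have hTH : ∀ {a b}, T'.Adj a b → H.Adj a b := fun h => hH ▸ Or.inl h
  have hFH : ∀ {a b}, F.Adj a b → (M.Adj a b → a ∈ A ∧ b ∈ A) → H.Adj a b :=
    fun h h' => hH ▸ Or.inr ⟨h, h'⟩
  refine ⟨H, ?_, ?_, ?_, ?_⟩
  · rw [hH]
    exact sup_le (hA.le.trans hTG) (le_trans (fun a b h => h.1) hFG)
  · rw [hH]
    have hle : F.edgesWithin A ≤ F.deleteOutside M A := fun a b h => ⟨h.1, fun _ => h.2⟩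
    exact hA.connected.mono (sup_le_sup le_rfl hle)
  · intro e
    induction e with | _ a b => ?_
    rintro ⟨hF, hM⟩
    exact hFH hF fun h => absurd h hM
  intro v
  have hsum : H.degree v ≤ T'.degree v + (F.deleteOutside M A).degree v :=
    SimpleGraph.degree_le_add_of_adj fun w h => by rwa [hH] at h
  have hTle : T'.degree v ≤ T.degree v := SimpleGraph.degree_le_of_adj fun _ h => hA.le h
  have hFle : (F.deleteOutside M A).degree v ≤ F.degree v :=
    SimpleGraph.degree_le_of_adj fun _ h => h.1
  by_cases hdrop : ∃ w, M.Adj v w ∧ ¬ (v ∈ A ∧ w ∈ A)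
  · obtain ⟨w, hvw, hnot⟩ := hdrop
    have hFlt : (F.deleteOutside M A).degree v < F.degree v :=
      SimpleGraph.degree_lt_of_adj (fun _ h => h.1) ⟨w, hMF hvw, fun h => hnot (h.2 hvw)⟩
    refine ⟨?_, by omega⟩
    obtain ⟨C, hQ, hCA, hvC, hfull⟩ : ∃ C, Q C ∧ x C ∉ A ∧ F.connectedComponentMk v = C ∧
        ∀ w, T.Adj (r C) w → T'.Adj (r C) w := by
      by_cases hv : v ∈ A
      · have hw : w ∉ A := fun hw => hnot ⟨hv, hw⟩
        obtain ⟨C, hQ, hCw, hfull⟩ := hout w hw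
        refine ⟨C, hQ, hCw ▸ hw, ?_, hfull⟩
        rw [hmk (hMF hvw), ← hCw, hxC C hQ]
      · obtain ⟨C, hQ, hCv, hfull⟩ := hout v hv
        exact ⟨C, hQ, hCv ▸ hv, by rw [← hCv, hxC C hQ], hfull⟩
    obtain ⟨u, hu⟩ : ∃ u, T'.Adj v u := by
      rcases Sym2.eq_iff.1 (hedge C hQ v w hvw hvC) with ⟨h1, -⟩ | ⟨h1, -⟩
      · obtain ⟨u, hu⟩ := hnbr v w (hMF hvw)
        exact ⟨u, hu.resolve_right fun h => hCA (h1 ▸ h.2.1)⟩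
      · obtain ⟨u, hu⟩ := hTnbr v w (hMF hvw)
        refine ⟨u, ?_⟩
        rw [h1] at hu ⊢
        exact hfull u hu
    refine SimpleGraph.degree_le_of_exchange (w := w) (u := u) ?_ (hMF hvw) (hTH hu) ?_
    · intro z hz hvz
      exact hFH hvz fun hM => absurd (hmatching v z w hM hvw) hz
    · intro hF
      exact hQ.2.2 v u hvC ((hmk hF).symm.trans hvC) (hA.le hu)
  · push Not at hdrop
    refine ⟨SimpleGraph.degree_le_of_adj fun w hw => hFH hw (hdrop w), ?_⟩
    by_cases hiso : ∃ w, F.Adj v w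
    · suffices hlt : T'.degree v < T.degree v by omega
      refine SimpleGraph.degree_lt_of_adj (fun _ h => hA.le h) ?_
      have hvA : v ∈ A := by
        by_contra hvA
        obtain ⟨C, hQ, hCv, -⟩ := hout v hvA
        exact hvA (hdrop (r C) (hCv ▸ hQ.1)).1
      by_cases hvr : ∀ C, v ≠ r C
      · exact hA.exists_missing v hvA hvr
      push Not at hvr
      obtain ⟨C, rfl⟩ := hvr
      by_cases hQ : Q C
      · exact hA.exists_missing_root C hQ (hdrop (x C) hQ.1.symm).2
      · rcases hr C with ⟨w, hw, hadj⟩ | h | h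
        · exact ⟨w, hadj, hinner C hQ w hw⟩
        · obtain ⟨w, hw⟩ := hiso
          exact absurd hw (h w)
        · exact absurd h hQ
    · have : F.degree v = 0 := by
        rw [← SimpleGraph.card_neighborFinset_eq_degree, Finset.card_eq_zero,
          Finset.eq_empty_iff_forall_notMem]
        intro w hw
        exact hiso ⟨w, by simpa using hw⟩
      omega
end

section
/- Let G be a finite simple graph, let g be a nonnegative integer-valued function on V(G), and let f, f' be positive integer-valued functions on V(G). If G contains a spanning subgraph F with g(v) ≤ deg_F(v) ≤ f(v) for every vertex v, and G contains a spanning tree T with deg_T(v) ≤ f'(v) for every vertex v, then G contains a connected spanning subgraph H with g(v) ≤ deg_H(v) ≤ f(v) + f'(v) − 1 for every vertex v. -/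
open scoped Classical

namespace SimpleGraph

variable {V : Type*}

/-- Adding an edge `uv` to a connected graph allows the removal of some other edge at `u`,
namely the first edge of a path from `u` to `v`. -/
theorem Connected.exists_adj_connected_exchange {K : SimpleGraph V} (hK : K.Connected) {u v : V}
    (huv : u ≠ v) (hnadj : ¬ K.Adj u v) :
    ∃ x, K.Adj u x ∧ ((K ⊔ edge u v) \ edge u x).Connected := by
  obtain ⟨p, hp⟩ := hK.exists_isPath u v
  cases p with
  | nil => exact absurd rfl huv
  | @cons _ x _ hux q =>
    rw [Walk.cons_isPath_iff] at hp
    refine ⟨x, hux, ?_⟩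
    have hxv : x ≠ v := by rintro rfl; exact hnadj hux
    refine (hK.mono le_sup_left).connected_delete_edge_of_not_isBridge ?_
    rw [isBridge_iff, not_not]
    have hadj : ((K ⊔ edge u v).deleteEdges {s(u, x)}).Adj u v := by
      simp only [deleteEdges_adj, sup_adj, edge_adj, Set.mem_singleton_iff]
      grind
    refine hadj.reachable.trans ⟨(q.transfer _ fun e he => ?_).reverse⟩
    rw [edgeSet_deleteEdges]
    refine ⟨edgeSet_mono le_sup_left (q.edges_subset_edgeSet he), ?_⟩
    rintro rfl
    exact hp.2 (q.fst_mem_support_of_mem_edges he)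

/-- A set of vertices none of which is isolated in a finite graph `F` can be covered by a subgraph
each of whose edges has an end in the set that lies on no other edge. -/
theorem exists_minimal_cover [Finite V] (F : SimpleGraph V) (S : Set V)
    (hS : ∀ v ∈ S, ∃ w, F.Adj v w) :
    ∃ E ≤ F, (∀ v ∈ S, ∃ w, E.Adj v w) ∧ ∀ u v, E.Adj u v →
      (u ∈ S ∧ ∀ w, E.Adj u w → w = v) ∨ (v ∈ S ∧ ∀ w, E.Adj v w → w = u) := by
  obtain ⟨E, hE⟩ :=
    (Set.toFinite {E : SimpleGraph V | E ≤ F ∧ ∀ v ∈ S, ∃ w, E.Adj v w}).exists_minimal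
      ⟨F, le_rfl, hS⟩
  obtain ⟨⟨hEF, hcov⟩, hmin⟩ := hE
  refine ⟨E, hEF, hcov, fun u v huv => ?_⟩
  by_contra! h
  obtain ⟨hu, hv⟩ := h
  have hle : E ≤ E \ edge u v := by
    refine hmin ⟨sdiff_le.trans hEF, fun s hs => ?_⟩ sdiff_le
    obtain ⟨w, hw⟩ := hcov s hs
    have key : ∃ w, E.Adj s w ∧ s(s, w) ≠ s(u, v) := by
      by_cases hsu : s = u
      · subst hsu
        obtain ⟨w, hw, hne⟩ := hu hs
        exact ⟨w, hw, by grind⟩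
      by_cases hsv : s = v
      · subst hsv
        obtain ⟨w, hw, hne⟩ := hv hs
        exact ⟨w, hw, by grind⟩
      exact ⟨w, hw, by grind⟩
    obtain ⟨w, hw, hne⟩ := key
    exact ⟨w, by simp only [sdiff_adj, edge_adj]; grind⟩
  have := hle huv
  simp [edge_adj, huv.ne] at this

/-- If `T` is connected and `S` is the set of non-isolated vertices of `F` that lie on no common
edge of `F` and `T`, then there is a set `D` of edges outside `F ⊓ T` which covers `S`, has at each
vertex no more edges than `T \ F`, and whose removal leaves `F ⊔ T` connected. -/
theorem Connected.exists_deletion [Fintype V] {T : SimpleGraph V} (hT : T.Connected)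
    (F : SimpleGraph V) :
    ∃ D ≤ F ⊔ T, ((F ⊔ T) \ D).Connected ∧ (∀ v, D.degree v ≤ (T \ F).degree v) ∧
      ∀ v, (∃ w, F.Adj v w) → (∀ w, F.Adj v w → ¬ T.Adj v w) → 0 < D.degree v := by
  let S : Set V := {v | (∃ w, F.Adj v w) ∧ ∀ w, F.Adj v w → ¬ T.Adj v w}
  obtain ⟨E, hEF, hEcov, hEpriv⟩ := exists_minimal_cover F S fun v hv => hv.1
  have hET : ∀ a b, E.Adj a b → ¬ T.Adj a b := by
    intro a b hab
    rcases hEpriv a b hab with h | h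
    · exact h.1.2 b (hEF hab)
    · exact fun hT => h.1.2 a (hEF hab).symm hT.symm
  obtain ⟨D, ⟨hDle, hDFT, hDcov, hDconn⟩, hmin⟩ :=
    (Set.toFinite {D : SimpleGraph V | D ≤ E ⊔ T ∧ (∀ a b, D.Adj a b → F.Adj a b → ¬ T.Adj a b) ∧
      (∀ v ∈ S, ∃ w, D.Adj v w) ∧ ((E ⊔ T) \ D).Connected}).exists_minimalFor (E ⊓ ·) _
    ⟨E, le_sup_left, fun a b hab _ => hET a b hab, hEcov, hT.mono fun a b hab => by
      simp only [sdiff_adj, sup_adj]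
      exact ⟨.inr hab, fun h => hET a b h hab⟩⟩
  have hexch : ∀ v x, E.Adj v x → D.Adj v x → x ∈ S → (∀ w, E.Adj x w → w = v) →
      v ∈ S ∧ ∀ w, D.Adj v w → w = x := by
    intro v x hE hD hx hpriv
    by_contra! hcon
    obtain ⟨t, hxt, hconn⟩ := hDconn.exists_adj_connected_exchange hE.ne' fun h => h.2 hD.symm
    simp only [sdiff_adj, sup_adj] at hxt
    obtain ⟨hxt, hxtD⟩ := hxt
    have htv : t ≠ v := by rintro rfl; exact hxtD hD.symm
    have hxtT : T.Adj x t := hxt.resolve_left fun h => htv (hpriv t h)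
    have hle := @hmin (D \ edge x v ⊔ edge x t) ⟨?_, ?_, ?_, ?_⟩ ?_
    · have := (hle : E ⊓ D ≤ _) (show (E ⊓ D).Adj v x from ⟨hE, hD⟩)
      simp [edge_adj, hE.ne, htv.symm] at this
    · intro a b hab
      simp only [sup_adj, sdiff_adj, edge_adj] at hab ⊢
      rcases hab with hab | ⟨⟨rfl, rfl⟩ | ⟨rfl, rfl⟩, -⟩
      · exact hDle hab.1
      · exact .inr hxtT
      · exact .inr hxtT.symm
    · intro a b hab
      simp only [sup_adj, sdiff_adj, edge_adj] at hab
      rcases hab with hab | ⟨⟨rfl, rfl⟩ | ⟨rfl, rfl⟩, -⟩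
      · exact hDFT a b hab.1
      · exact hx.2 _
      · exact fun h h' => hx.2 _ h.symm h'.symm
    · intro s hs
      by_cases hsx : s = x
      · subst hsx
        exact ⟨t, .inr (by simp [edge_adj, hxtT.ne])⟩
      by_cases hsv : s = v
      · subst hsv
        obtain ⟨w, hw, hwx⟩ := hcon hs
        exact ⟨w, .inl ⟨hw, by simp [edge_adj, hwx, hsx]⟩⟩
      obtain ⟨w, hw⟩ := hDcov s hs
      exact ⟨w, .inl ⟨hw, by simp [edge_adj, hsx, hsv]⟩⟩
    · refine hconn.mono fun a b hab => ?_
      simp only [sup_adj, sdiff_adj, edge_adj] at hab ⊢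
      have := hE.symm
      grind [adj_comm]
    · intro a b hab
      simp only [inf_adj, sup_adj, sdiff_adj, edge_adj] at hab ⊢
      rcases hab with ⟨h, hab | ⟨⟨rfl, rfl⟩ | ⟨rfl, rfl⟩, -⟩⟩
      · exact ⟨h, hab.1⟩
      · exact absurd hxtT (hET _ _ h)
      · exact absurd hxtT.symm (hET _ _ h)
  refine ⟨D, hDle.trans (sup_le_sup_right hEF T), hDconn.mono ?_, fun v => ?_, fun v h1 h2 => ?_⟩
  · exact sdiff_le_sdiff_right (sup_le_sup_right hEF T)
  · by_cases hj : ∃ x, E.Adj v x ∧ D.Adj v x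
    · obtain ⟨x, hE, hD⟩ := hj
      have : Nontrivial V := ⟨v, x, hE.ne⟩
      have hsub : ∀ t, v ∈ S → T.Adj v t → (T \ F).Adj v t :=
        fun t hv h => ⟨h, fun hF => hv.2 t hF h⟩
      by_cases hx : x ∈ S ∧ ∀ w, E.Adj x w → w = v
      · obtain ⟨hv, hDv⟩ := hexch v x hE hD hx.1 hx.2
        obtain ⟨t, ht⟩ := hT.preconnected.exists_adj_of_nontrivial v
        calc D.degree v ≤ ({x} : Finset V).card :=
              Finset.card_le_card fun w hw => by
                simpa using hDv w ((D.mem_neighborFinset v w).1 hw)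
          _ = 1 := rfl
          _ ≤ _ := (hsub t hv ht).degree_pos_left
      · obtain ⟨hv, hpriv⟩ := (hEpriv v x hE).resolve_right hx
        obtain ⟨t, ht, htD⟩ := hDconn.preconnected.exists_adj_of_nontrivial v
        have htT : T.Adj v t := ht.resolve_left fun h => htD (hpriv t h ▸ hD)
        have hmem : t ∈ (T \ F).neighborFinset v :=
          (mem_neighborFinset _ _ _).2 (hsub t hv htT)
        calc D.degree v ≤ (insert x (((T \ F).neighborFinset v).erase t)).card := by
              refine Finset.card_le_card fun w hw => ?_
              rw [mem_neighborFinset] at hw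
              simp only [Finset.mem_insert, Finset.mem_erase, mem_neighborFinset]
              rcases hDle hw with h | h
              · exact .inl (hpriv w h)
              · exact .inr ⟨fun h => htD (h ▸ hw), hsub w hv h⟩
          _ ≤ (((T \ F).neighborFinset v).erase t).card + 1 := Finset.card_insert_le _ _
          _ = (T \ F).degree v := Finset.card_erase_add_one hmem
    · push Not at hj
      refine Finset.card_le_card fun w hw => ?_
      rw [mem_neighborFinset] at hw ⊢
      have hwT : T.Adj v w := (hDle hw).resolve_left fun h => hj w h hw
      exact ⟨hwT, fun hF => hDFT v w hw hF hwT⟩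
  · obtain ⟨w, hw⟩ := hDcov v ⟨h1, h2⟩
    exact hw.degree_pos_left

end SimpleGraph

/-- Refined Tokuda–Xu–Wang: if `G` has a `(g,f)`-factor (with `g ≥ 0`, `f ≥ 1`) and a
spanning `f'`-tree (with `f' ≥ 1`), then `G` has a connected `(g, f + f' - 1)`-factor. -/
theorem connected_factor_of_spanning_tree_nonneg {V : Type*} [Fintype V]
    (G : SimpleGraph V) (g f f' : V → ℤ)
    (hg0 : ∀ v, 0 ≤ g v) (hf1 : ∀ v, 1 ≤ f v) (hf'1 : ∀ v, 1 ≤ f' v)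
    (F : SimpleGraph V) (hFG : F ≤ G)
    (hFdeg : ∀ v, g v ≤ (F.degree v : ℤ) ∧ (F.degree v : ℤ) ≤ f v)
    (T : SimpleGraph V) (hTG : T ≤ G) (hT : T.IsTree)
    (hTdeg : ∀ v, (T.degree v : ℤ) ≤ f' v) :
    ∃ H : SimpleGraph V, H ≤ G ∧ H.Connected ∧
      ∀ v, g v ≤ (H.degree v : ℤ) ∧ (H.degree v : ℤ) ≤ f v + f' v - 1 := by
  obtain ⟨D, hD, hconn, hDT, hDpos⟩ := hT.connected.exists_deletion F
  refine ⟨(F ⊔ T) \ D, sdiff_le.trans (sup_le hFG hTG), hconn, fun v => ?_⟩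
  have hdeg : ∀ H, H = (F ⊔ T) \ D →
      H.degree v + D.degree v = F.degree v + (T \ F).degree v := by
    rintro H rfl
    simp only [← SimpleGraph.card_neighborFinset_eq_degree, SimpleGraph.neighborFinset_sdiff]
    rw [Finset.card_sdiff_add_card_eq_card, SimpleGraph.neighborFinset_sup,
      ← Finset.card_union_of_disjoint Finset.disjoint_sdiff, Finset.union_sdiff_self_eq_union]
    intro w hw
    rw [SimpleGraph.mem_neighborFinset] at hw ⊢
    exact hD hw
  have h0 := hdeg _ rfl
  have hle : (T \ F).degree v ≤ T.degree v := SimpleGraph.degree_le_of_le sdiff_le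
  have h1 := hDT v
  have h2 := hFdeg v
  have h3 := hTdeg v
  have h4 := hf1 v
  refine ⟨by omega, ?_⟩
  by_cases hF : ∃ w, F.Adj v w
  · by_cases hFT : ∀ w, F.Adj v w → ¬ T.Adj v w
    · have := hDpos v hF hFT
      omega
    · push Not at hFT
      obtain ⟨w, hw, hwT⟩ := hFT
      have : (T \ F).degree v < T.degree v := by
        refine Finset.card_lt_card (Finset.ssubset_iff_of_subset ?_ |>.2 ⟨w, ?_, ?_⟩)
        · exact fun x hx => by
            rw [SimpleGraph.mem_neighborFinset] at hx ⊢
            exact hx.1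
        · simpa using hwT
        · simp [hw]
      omega
  · have : F.degree v = 0 := by
      by_contra h
      exact hF ((F.degree_pos_iff_exists_adj v).1 (Nat.pos_of_ne_zero h))
    omega
end

section
/- Let m be a positive integer and let G be a finite simple graph with a spanning subgraph F and a spanning subgraph T having m pairwise edge-disjoint spanning trees. Let A = {v ∈ V(G) : deg_F(v) ≤ m}, and suppose the graph F \ E(T) (the spanning subgraph of G with edge set E(F) \ E(T)) is bipartite with one partite set equal to A, i.e., every edge of E(F) \ E(T) has exactly one endpoint in A. Let M be a spanning subgraph of F \ E(T) such that for every vertex v ∉ A, deg_M(v) + deg_{F∩T}(v) ≥ m, where F∩T is the spanning subgraph with edge set E(F) ∩ E(T). Then G has a spanning subgraph H that has m pairwise edge-disjoint spanning trees, whose edge set contains E(F) \ E(M), and such that for every vertex v, deg_F(v) ≤ deg_H(v) ≤ deg_T(v) + max{0, deg_F(v) − m}. -/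
open scoped Classical

namespace SimpleGraph

variable {V : Type*}

/-- `m` pairwise edge-disjoint connected spanning subgraphs suffice for `m`-tree-connectedness. -/
theorem TreeConnected.of_connected_s7 {G : SimpleGraph V} {m : ℕ} [Finite V]
    (T : Fin m → SimpleGraph V) (hle : ∀ i, T i ≤ G) (hconn : ∀ i, (T i).Connected)
    (hdisj : ∀ i j, i ≠ j → Disjoint (T i).edgeSet (T j).edgeSet) : G.TreeConnected m := by
  choose S hS hSt using fun i => (hconn i).exists_isTree_le
  exact ⟨S, fun i => ⟨(hS i).trans (hle i), hSt i⟩, fun i j hij =>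
    (hdisj i j hij).mono (edgeSet_mono (hS i)) (edgeSet_mono (hS j))⟩

/-- In a connected graph, an edge at `x` can be replaced by a new edge `xy` keeping
connectedness. -/
theorem Connected.exists_adj_connected_exchange_s7 {G : SimpleGraph V} (hG : G.Connected) {x y : V}
    (hxy : x ≠ y) : ∃ z, G.Adj x z ∧ (G \ edge x z ⊔ edge x y).Connected := by
  obtain ⟨p, hp⟩ := hG.exists_isPath x y
  cases p with
  | nil => exact absurd rfl hxy
  | @cons _ z _ h q =>
    rw [Walk.cons_isPath_iff] at hp
    refine ⟨z, h, ?_⟩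
    set K := G \ edge x z ⊔ edge x y with hK
    have hyx : K.Reachable x y := Adj.reachable (by simp [hK, edge_adj, hxy])
    have hq : ∀ e ∈ q.edges, e ∈ K.edgeSet := by
      intro e he
      induction e with
      | _ a b =>
        have ha := q.fst_mem_support_of_mem_edges he
        have hb := q.snd_mem_support_of_mem_edges he
        have hab := q.adj_of_mem_edges he
        simp only [hK, mem_edgeSet, sup_adj, sdiff_adj, edge_adj]
        grind
    have hxz : K.Reachable x z := hyx.trans (q.transfer K hq).reachable.symm
    have hadj : ∀ a b, G.Adj a b → K.Reachable a b := by
      intro a b hab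
      by_cases he : (edge x z).Adj a b
      · rw [edge_adj] at he
        rcases he.1 with ⟨rfl, rfl⟩ | ⟨rfl, rfl⟩
        · exact hxz
        · exact hxz.symm
      · exact Adj.reachable (Or.inl ⟨hab, he⟩)
    have : Nonempty V := ⟨x⟩
    refine ⟨fun a b => ?_⟩
    obtain ⟨w⟩ := hG a b
    induction w with
    | nil => rfl
    | cons h _ ih => exact (hadj _ _ h).trans ih

theorem degree_lt_degree_of_le {G H : SimpleGraph V} {v w : V} [Fintype (G.neighborSet v)]
    [Fintype (H.neighborSet v)] (h : G ≤ H) (hH : H.Adj v w) (hG : ¬ G.Adj v w) :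
    G.degree v < H.degree v := by
  refine Finset.card_lt_card (Finset.ssubset_iff_of_subset ?_ |>.2 ⟨w, ?_, ?_⟩)
  · exact fun u hu => by simpa using h (by simpa using hu)
  · simpa using hH
  · simpa using hG

theorem degree_add_degree_eq {G H K : SimpleGraph V} {v : V} [Fintype (G.neighborSet v)]
    [Fintype (H.neighborSet v)] [Fintype (K.neighborSet v)]
    (hK : ∀ u, K.Adj v u ↔ G.Adj v u ∨ H.Adj v u) (hd : ∀ u, G.Adj v u → ¬ H.Adj v u) :
    G.degree v + H.degree v = K.degree v := by
  simp only [← card_neighborFinset_eq_degree]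
  rw [← Finset.card_union_of_disjoint]
  · congr 1
    ext u
    simp [hK]
  · simpa [Finset.disjoint_left] using hd

variable [Fintype V]

/-- Every `m`-tree-connected graph on at least two vertices has minimum degree at least `m`. -/
theorem TreeConnected.le_degree [Nontrivial V] {H : SimpleGraph V} {m : ℕ}
    (hH : H.TreeConnected m) (v : V) : m ≤ H.degree v := by
  obtain ⟨T, hT, hdisj⟩ := hH
  have hex : ∀ i, ∃ w, (T i).Adj v w := fun i =>
    (degree_pos_iff_exists_adj _ v).1 ((hT i).2.connected.preconnected.degree_pos_of_nontrivial v)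
  choose w hw using hex
  have hinj : Function.Injective w := by
    intro i j hij
    by_contra hne
    have hj : s(v, w i) ∈ (T j).edgeSet := by
      rw [hij]
      exact hw j
    exact Set.disjoint_left.1 (hdisj i j hne) (hw i) hj
  calc m = (Finset.univ.image w).card := by simp [Finset.card_image_of_injective _ hinj]
    _ ≤ H.degree v := Finset.card_le_card fun u hu => by
      obtain ⟨i, -, rfl⟩ := Finset.mem_image.1 hu
      simpa using (hT i).1 (hw i)

/-- An edge `xy` of `F` with `deg_F(x) ≤ m` can be added to an `m`-tree-connected graph in exchange
for an edge at `x` outside `F`. -/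
theorem TreeConnected.exists_exchange {H F : SimpleGraph V} {m : ℕ} (hH : H.TreeConnected m)
    {x y : V} (hF : F.Adj x y) (hxy : ¬ H.Adj x y) (hx : F.degree x ≤ m) :
    ∃ z, H.Adj x z ∧ ¬ F.Adj x z ∧ (H \ edge x z ⊔ edge x y).TreeConnected m := by
  obtain ⟨T, hT, hdisj⟩ := hH
  choose z hz hc using fun i => (hT i).2.connected.exists_adj_connected_exchange_s7 hF.ne
  have hinj : Function.Injective z := by
    intro i j hij
    by_contra hne
    have hj : s(x, z i) ∈ (T j).edgeSet := by
      rw [hij]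
      exact hz j
    exact Set.disjoint_left.1 (hdisj i j hne) (hz i) hj
  obtain ⟨i, hi⟩ : ∃ i, ¬ F.Adj x (z i) := by
    by_contra! hall
    have hy : y ∉ Finset.univ.image z := by
      intro h
      obtain ⟨i, -, rfl⟩ := Finset.mem_image.1 h
      exact hxy ((hT i).1 (hz i))
    have hcard : (insert y (Finset.univ.image z)).card ≤ F.degree x :=
      Finset.card_le_card fun u hu => by
        rcases Finset.mem_insert.1 hu with rfl | hu
        · simpa using hF
        · obtain ⟨i, -, rfl⟩ := Finset.mem_image.1 hu
          simpa using hall i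
    rw [Finset.card_insert_of_notMem hy, Finset.card_image_of_injective _ hinj] at hcard
    simp at hcard
    omega
  have hd : ∀ i j a b, (T i).Adj a b → (T j).Adj a b → i = j := fun i j a b h h' => by
    by_contra hne
    have hi : s(a, b) ∈ (T i).edgeSet := h
    have hj : s(a, b) ∈ (T j).edgeSet := h'
    exact Set.disjoint_left.1 (hdisj i j hne) hi hj
  refine ⟨z i, (hT i).1 (hz i), hi, TreeConnected.of_connected_s7
    (fun j => if j = i then T i \ edge x (z i) ⊔ edge x y else T j) ?_ ?_ ?_⟩
  · intro j
    split_ifs with h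
    · exact sup_le_sup_right (sdiff_le_sdiff_right (hT i).1) _
    · refine le_sup_of_le_left fun a b hab => ⟨(hT j).1 hab, fun he => h ?_⟩
      rw [edge_adj] at he
      rcases he.1 with ⟨rfl, rfl⟩ | ⟨rfl, rfl⟩
      · exact hd j i _ _ hab (hz i)
      · exact hd j i _ _ hab.symm (hz i)
  · intro j
    split_ifs with h
    · exact hc i
    · exact (hT j).2.connected
  · have key : ∀ j, j ≠ i → ∀ a b, (T j).Adj a b → ¬ (T i \ edge x (z i) ⊔ edge x y).Adj a b := by
      rintro j hj a b hab (h | h)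
      · exact hj (hd j i a b hab h.1)
      · rw [edge_adj] at h
        rcases h.1 with ⟨rfl, rfl⟩ | ⟨rfl, rfl⟩
        · exact hxy ((hT j).1 hab)
        · exact hxy ((hT j).1 hab.symm)
    intro j k hjk
    rw [Set.disjoint_left]
    intro e
    induction e with
    | _ a b =>
      simp only [mem_edgeSet]
      intro h h'
      split_ifs at h h' with h1 h2 h2
      · exact hjk (h1.trans h2.symm)
      · exact key k h2 a b h' h
      · exact key j h1 a b h h'
      · exact hjk (hd j k a b h h')

/-- The exchange step of `TreeConnected.exists_exchange` in terms of degrees. -/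
theorem TreeConnected.exists_add_adj {H F : SimpleGraph V} {m : ℕ} (hH : H.TreeConnected m)
    {x y : V} (hF : F.Adj x y) (hxy : ¬ H.Adj x y) (hx : F.degree x ≤ m) :
    ∃ H' : SimpleGraph V, H'.TreeConnected m ∧ H' ≤ H ⊔ F ∧ F ⊓ H ≤ H' ∧ H'.Adj x y ∧
      (∀ v, v ≠ y → H'.degree v ≤ H.degree v) ∧ H'.degree y ≤ H.degree y + 1 := by
  obtain ⟨z, hz, hFz, hT⟩ := hH.exists_exchange hF hxy hx
  obtain ⟨K, hK⟩ : ∃ K, K = H \ edge x z ⊔ edge x y := ⟨_, rfl⟩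
  rw [← hK] at hT
  have hadj : ∀ a b, K.Adj a b ↔ H.Adj a b ∧ ¬ (a = x ∧ b = z ∨ a = z ∧ b = x) ∨
      (a = x ∧ b = y ∨ a = y ∧ b = x) := by
    intro a b
    simp only [hK, sup_adj, sdiff_adj, edge_adj]
    grind [hF.ne, H.ne_of_adj]
  refine ⟨K, hT, ?_, ?_, ?_, ?_, ?_⟩
  · intro a b h
    rcases (hadj a b).1 h with h | ⟨rfl, rfl⟩ | ⟨rfl, rfl⟩
    · exact Or.inl h.1
    · exact Or.inr hF
    · exact Or.inr hF.symm
  · rintro a b ⟨h, h'⟩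
    refine (hadj a b).2 (Or.inl ⟨h', ?_⟩)
    rintro (⟨rfl, rfl⟩ | ⟨rfl, rfl⟩)
    · exact hFz h
    · exact hFz h.symm
  · exact (hadj x y).2 (Or.inr (Or.inl ⟨rfl, rfl⟩))
  · intro v hv
    simp only [← card_neighborFinset_eq_degree]
    by_cases hvx : v = x
    · subst hvx
      have hzv : z ∈ H.neighborFinset v := by simpa using hz
      have hsub : K.neighborFinset v ⊆ insert y ((H.neighborFinset v).erase z) := by
        intro u
        simp only [mem_neighborFinset, hadj, Finset.mem_insert, Finset.mem_erase]
        grind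
      calc _ ≤ _ := Finset.card_le_card hsub
        _ ≤ _ := Finset.card_insert_le _ _
        _ = _ := Finset.card_erase_add_one hzv
    · refine Finset.card_le_card fun u => ?_
      simp only [mem_neighborFinset, hadj]
      grind
  · simp only [← card_neighborFinset_eq_degree]
    have hsub : K.neighborFinset y ⊆ insert x (H.neighborFinset y) := by
      intro u
      simp only [mem_neighborFinset, hadj, Finset.mem_insert]
      grind
    exact (Finset.card_le_card hsub).trans (Finset.card_insert_le _ _)

/-- Absorb all edges of `F` outside `M` by exchanges. -/
theorem TreeConnected.exists_sdiff_le {m : ℕ} {F M H : SimpleGraph V} {d : V → ℕ}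
    (hH : H.TreeConnected m)
    (hbip : ∀ v w, (F \ H).Adj v w → (F.degree v ≤ m ↔ ¬ F.degree w ≤ m))
    (hd : ∀ v, H.degree v + (if F.degree v ≤ m then 0 else ((F \ M) \ H).degree v) ≤ d v) :
    ∃ H' : SimpleGraph V, H' ≤ H ⊔ F ∧ H'.TreeConnected m ∧ F ⊓ H ≤ H' ∧ F \ M ≤ H' ∧
      ∀ v, H'.degree v ≤ d v := by
  induction hn : F \ H using WellFoundedLT.induction generalizing H with
  | _ K ih =>
  subst hn
  by_cases hle : F \ M ≤ H
  · exact ⟨H, le_sup_left, hH, inf_le_right, hle, fun v => (Nat.le_add_right _ _).trans (hd v)⟩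
  obtain ⟨x, y, hxy, hHxy, hx⟩ : ∃ x y, (F \ M).Adj x y ∧ ¬ H.Adj x y ∧ F.degree x ≤ m := by
    have hex : ∃ x y, (F \ M).Adj x y ∧ ¬ H.Adj x y := by
      by_contra! h
      exact hle fun a b => h a b
    obtain ⟨a, b, hab, hHab⟩ := hex
    by_cases ha : F.degree a ≤ m
    · exact ⟨a, b, hab, hHab, ha⟩
    · refine ⟨b, a, hab.symm, fun h => hHab h.symm, ?_⟩
      have := hbip a b ⟨hab.1, hHab⟩
      tauto
  have hy : ¬ F.degree y ≤ m := (hbip x y ⟨hxy.1, hHxy⟩).1 hx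
  obtain ⟨H', hT', hle', hinf', hadj', hdeg', hdegy'⟩ := hH.exists_add_adj hxy.1 hHxy hx
  have hsd : ∀ K, K ≤ F → K \ H' ≤ K \ H := fun K hK a b h =>
    ⟨h.1, fun h' => h.2 (hinf' ⟨hK h.1, h'⟩)⟩
  have hlt : F \ H' < F \ H := by
    refine lt_of_le_of_ne (hsd F le_rfl) fun h => ?_
    have : (F \ H').Adj x y := h ▸ ⟨hxy.1, hHxy⟩
    exact this.2 hadj'
  obtain ⟨H'', h1, h2, h3, h4, h5⟩ := ih _ hlt hT'
    (fun v w h => hbip v w (hsd F le_rfl h)) (fun v => by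
      refine le_trans ?_ (hd v)
      by_cases hv : v = y
      · subst hv
        have := degree_lt_degree_of_le (hsd (F \ M) sdiff_le) (v := v) (w := x)
          ⟨hxy.symm, fun h => hHxy h.symm⟩ (fun h => h.2 hadj'.symm)
        simp only [hy, if_false]
        omega
      · have h1 := hdeg' v hv
        have h2 := degree_le_of_le (v := v) (hsd (F \ M) sdiff_le)
        split_ifs
        · omega
        · omega) rfl
  refine ⟨H'', h1.trans (sup_le hle' le_sup_right), h2, ?_, h4, h5⟩
  exact fun a b h => h3 ⟨h.1, hinf' h⟩

/-- Absorb further edges of `M` at the vertices whose degree is too small. -/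
theorem TreeConnected.exists_degree_le {m : ℕ} {F M H : SimpleGraph V} {d : V → ℕ}
    (hH : H.TreeConnected m) (hFM : F \ M ≤ H)
    (hbip : ∀ v w, (F \ H).Adj v w → (F.degree v ≤ m ↔ ¬ F.degree w ≤ m))
    (hd : ∀ v, H.degree v ≤ d v) (hF : ∀ v, m < F.degree v → F.degree v ≤ d v) :
    ∃ H' : SimpleGraph V, H' ≤ H ⊔ F ∧ H'.TreeConnected m ∧ F \ M ≤ H' ∧
      (∀ v, H'.degree v ≤ d v) ∧ ∀ v, m < F.degree v → F.degree v ≤ H'.degree v := by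
  induction hn : F \ H using WellFoundedLT.induction generalizing H with
  | _ K ih =>
  subst hn
  by_cases hdone : ∀ v, m < F.degree v → F.degree v ≤ H.degree v
  · exact ⟨H, le_sup_left, hH, hFM, hd, hdone⟩
  push Not at hdone
  obtain ⟨y, hy, hlt⟩ := hdone
  obtain ⟨x, hyx, hHyx⟩ : ∃ x, F.Adj y x ∧ ¬ H.Adj y x := by
    by_contra! h
    refine hlt.not_ge (Finset.card_le_card fun u hu => ?_)
    simpa using h u (by simpa using hu)
  have hx : F.degree x ≤ m := by
    have := hbip y x ⟨hyx, hHyx⟩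
    by_contra hx
    exact absurd (this.2 hx) (by omega)
  obtain ⟨H', hT', hle', hinf', hadj', hdeg', hdegy'⟩ :=
    hH.exists_add_adj hyx.symm (fun h => hHyx h.symm) hx
  have hsd : F \ H' ≤ F \ H := fun a b h => ⟨h.1, fun h' => h.2 (hinf' ⟨h.1, h'⟩)⟩
  have hlt' : F \ H' < F \ H := by
    refine lt_of_le_of_ne hsd fun h => ?_
    have : (F \ H').Adj y x := h ▸ ⟨hyx, hHyx⟩
    exact this.2 hadj'.symm
  obtain ⟨H'', h1, h2, h3, h4, h5⟩ := ih _ hlt' hT' (fun a b h => hinf' ⟨h.1, hFM h⟩)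
    (fun v w h => hbip v w (hsd h)) (fun v => by
      by_cases hv : v = y
      · subst hv
        have := hF v hy
        omega
      · exact (hdeg' v hv).trans (hd v)) rfl
  exact ⟨H'', h1.trans (sup_le hle' le_sup_right), h2, h3, h4, h5⟩

end SimpleGraph

/-- Let `F` be a spanning subgraph and `T` an `m`-tree-connected spanning subgraph of `G`,
with `A = {v : deg_F(v) ≤ m}`.  Suppose every edge of `F \ E(T)` has exactly one endpoint
in `A`, and `M` is a spanning subgraph of `F \ E(T)` with `deg_M(v) + deg_{F∩T}(v) ≥ m` for
every `v ∉ A`.  Then `G` has an `m`-tree-connected spanning subgraph `H` containing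
`E(F) \ E(M)` with `deg_F(v) ≤ deg_H(v) ≤ deg_T(v) + max {0, deg_F(v) - m}` for all `v`. -/
theorem treeConnected_factor_of_bipartite_difference {V : Type*} [Fintype V]
    (m : ℕ) (hm : 0 < m) (G : SimpleGraph V)
    (F T : SimpleGraph V) (hFG : F ≤ G) (hTG : T ≤ G)
    (hT : T.TreeConnected m)
    (A : Set V) (hA : A = {v : V | F.degree v ≤ m})
    (hbip : ∀ v w : V, (F \ T).Adj v w → (v ∈ A ↔ w ∉ A))
    (M : SimpleGraph V) (hM : M ≤ F \ T)
    (hMdeg : ∀ v ∉ A, m ≤ M.degree v + (F ⊓ T).degree v) :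
    ∃ H : SimpleGraph V, H ≤ G ∧ H.TreeConnected m ∧
      F.edgeSet \ M.edgeSet ⊆ H.edgeSet ∧
      ∀ v, F.degree v ≤ H.degree v ∧
        (H.degree v : ℤ) ≤ (T.degree v : ℤ) + max 0 ((F.degree v : ℤ) - m) := by
  subst hA
  have hmd : ∀ v, m < F.degree v → m ≤ T.degree v := by
    intro v hv
    obtain ⟨w, hw⟩ := (F.degree_pos_iff_exists_adj v).1 (by omega)
    have : Nontrivial V := ⟨v, w, hw.ne⟩
    exact hT.le_degree v
  have hbip' : ∀ v w, (F \ T).Adj v w → (F.degree v ≤ m ↔ ¬ F.degree w ≤ m) := hbip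
  obtain ⟨H₁, hle₁, hT₁, hinf₁, hFM₁, hd₁⟩ := hT.exists_sdiff_le (M := M) hbip'
    (d := fun v => T.degree v + (F.degree v - m)) (fun v => by
      split_ifs with hv
      · omega
      · have h1 : (F ⊓ T).degree v + (F \ T).degree v = F.degree v :=
          SimpleGraph.degree_add_degree_eq (fun u => by simp; tauto) (fun u => by simp; tauto)
        have h2 : M.degree v + ((F \ M) \ T).degree v = (F \ T).degree v :=
          SimpleGraph.degree_add_degree_eq
            (fun u => by
              have : M.Adj v u → (F \ T).Adj v u := fun h => hM h
              simp only [SimpleGraph.sdiff_adj] at this ⊢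
              tauto)
            (fun u => by simp; tauto)
        have h3 := hMdeg v hv
        omega)
  obtain ⟨H, hle, hTH, hFM, hd, hlow⟩ := hT₁.exists_degree_le hFM₁
    (fun v w h => hbip' v w ⟨h.1, fun h' => h.2 (hinf₁ ⟨h.1, h'⟩)⟩) hd₁
    (fun v hv => by have := hmd v hv; omega)
  refine ⟨H, hle.trans (sup_le (hle₁.trans (sup_le hTG hFG)) hFG), hTH, ?_, fun v => ⟨?_, ?_⟩⟩
  · rw [← SimpleGraph.edgeSet_sdiff]
    exact SimpleGraph.edgeSet_mono hFM
  · by_cases hv : F.degree v ≤ m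
    · rcases Nat.eq_zero_or_pos (F.degree v) with h0 | h0
      · omega
      · obtain ⟨w, hw⟩ := (F.degree_pos_iff_exists_adj v).1 h0
        have : Nontrivial V := ⟨v, w, hw.ne⟩
        exact hv.trans (hTH.le_degree v)
    · exact hlow v (by omega)
  · have := hd v
    omega
end
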